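/- Let (X, X̂, X̃) be a metrizable compactification pack such that X is a cylindrical subset of X̃, let d be a metric on X̃ inducing its topology, and let ℰ₀ be the C₀ coarse structure on X̂. For every n ∈ ℕ the following are equivalent: (a) dim X ≤ n; (b) asdim(X̂, ℰ₀) ≤ n + 1; (c) for every uniform cover β of X̂ there is a canonical cover α with β ≺ α and mult α ≤ n + 2; (d) for every canonical cover β there is a canonical cover α with β ≺ α and mult α ≤ n + 2; (e) there exists a canonical cover α with mult α ≤ n + 2; (f) there exists an open uniform cover α of X̂ with mult α ≤ n + 2. -/

import Mathlib

open Set Metric Topology Filter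

/-- `Δ(α) = ⋃_{U ∈ α} U × U`. -/
def deltaFam {Z : Type*} (α : Set (Set Z)) : Set (Z × Z) := ⋃ U ∈ α, U ×ˢ U

/-- `E(A) = {y : ∃ x ∈ A, (y, x) ∈ E}`. -/
def eApply {Z : Type*} (E : Set (Z × Z)) (A : Set Z) : Set Z := {y | ∃ x ∈ A, (y, x) ∈ E}

/-- `E⁻¹ = {(y,x) : (x,y) ∈ E}`. -/
def invRel {Z : Type*} (E : Set (Z × Z)) : Set (Z × Z) := {p | (p.2, p.1) ∈ E}

/-- `α(A) = ⋃ {U ∈ α : U ∩ A ≠ ∅}`. -/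
def famApply {Z : Type*} (α : Set (Set Z)) (A : Set Z) : Set Z :=
  ⋃₀ {U ∈ α | (U ∩ A).Nonempty}

/-- `β ≺ α`: every member of `β` is contained in some member of `α`. -/
def Refines {Z : Type*} (β α : Set (Set Z)) : Prop := ∀ V ∈ β, ∃ U ∈ α, V ⊆ U

/-- `mult α ≤ m`: every finite subfamily of `α` with nonempty intersection has
cardinality at most `m`. -/
def MultLE {Z : Type*} (α : Set (Set Z)) (m : ℕ) : Prop :=
  ∀ S : Finset (Set Z), ↑S ⊆ α → (⋂₀ (S : Set (Set Z))).Nonempty → S.card ≤ m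

/-- A family `α` is locally finite in `hX`:every point of `hX` has a neighborhood meeting
only finitely many members of `α`. -/
def LocallyFiniteIn {Z : Type*} [TopologicalSpace Z] (hX : Set Z) (α : Set (Set Z)) : Prop :=
  ∀ x ∈ hX, ∃ V : Set Z, IsOpen V ∧ x ∈ V ∧ {U ∈ α | (U ∩ V).Nonempty}.Finite

/-- Covering dimension at most `n` (an integer; the empty space has dimension `-1`);
for `n ≥ 0` this is the usual condition that every finite open cover admits a finite
open refinement, still covering, of multiplicity at most `n + 1`. -/
def DimLE (Y : Type*) [TopologicalSpace Y] (n : ℤ) : Prop :=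
  (IsEmpty Y ∧ -1 ≤ n) ∨
  ∃ m : ℕ, (m : ℤ) = n ∧
    ∀ α : Set (Set Y), α.Finite → (∀ U ∈ α, IsOpen U) → ⋃₀ α = univ →
      ∃ β : Set (Set Y), β.Finite ∧ (∀ V ∈ β, IsOpen V) ∧ ⋃₀ β = univ ∧
        Refines β α ∧ MultLE β (m + 1)

/-- `E` belongs to the C₀ coarse structure on `hX` (with the metric of the ambient
space): for every `ε > 0` there is a compact `K ⊆ hX` with `dist x y < ε` for every
`(x, y) ∈ E \ (K × K)`. -/
def MemC0 {T : Type*} [MetricSpace T] (hX : Set T) (E : Set (T × T)) : Prop :=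
  E ⊆ hX ×ˢ hX ∧
  ∀ ε > 0, ∃ K : Set T, K ⊆ hX ∧ IsCompact K ∧
    ∀ p ∈ E \ K ×ˢ K, dist p.1 p.2 < ε

/-- A family of subsets of `hX` is uniform if `Δ(α) ∈ ℰ₀`. -/
def IsUniformFam {T : Type*} [MetricSpace T] (hX : Set T) (α : Set (Set T)) : Prop :=
  MemC0 hX (deltaFam α)

/-- A uniform cover of `hX`. -/
def IsUniformCover {T : Type*} [MetricSpace T] (hX : Set T) (α : Set (Set T)) : Prop :=
  IsUniformFam hX α ∧ ⋃₀ α = hX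

/-- A canonical cover of the compactification pack `(X, Xᶜ, T)`: an open, locally
finite cover `α` of `X̂ = Xᶜ` such that for every `x ∈ X` and every neighborhood `V`
of `x` there is a neighborhood `W` of `x` with `α(W ∩ X̂) ⊆ V`. -/
def IsCanonicalCover {T : Type*} [TopologicalSpace T] (X : Set T) (α : Set (Set T)) : Prop :=
  (∀ U ∈ α, IsOpen U ∧ U ⊆ Xᶜ) ∧ ⋃₀ α = Xᶜ ∧ LocallyFiniteIn Xᶜ α ∧
  ∀ x ∈ X, ∀ V ∈ 𝓝 x, ∃ W ∈ 𝓝 x, famApply α (W ∩ Xᶜ) ⊆ V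

/-- `asdim (hX, ℰ₀) ≤ m`: every uniform cover admits a uniform coarsening of
multiplicity at most `m + 1`. -/
def AsdimLE {T : Type*} [MetricSpace T] (hX : Set T) (m : ℕ) : Prop :=
  ∀ β, IsUniformCover hX β → ∃ α, IsUniformCover hX α ∧ Refines β α ∧ MultLE α (m + 1)

/-- `X` is a cylindrical subset of `T`. -/
def IsCylindrical (T : Type*) [TopologicalSpace T] (X : Set T) : Prop :=
  ∃ j : X × unitInterval → T, Topology.IsEmbedding j ∧ ∀ x : X, j (x, 0) = (x : T)

/-- `X` is a Z-set of the metric space `T`. -/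
def IsZSet {T : Type*} [MetricSpace T] (X : Set T) : Prop :=
  IsClosed X ∧ ∀ ε > 0, ∃ f : T → T, Continuous f ∧ (∀ z, dist (f z) z < ε) ∧
    Set.range f ∩ X = ∅

theorem exists_levels {Z : Type*} {β : Set (Set Z)} {r : Z → ℝ} {R : ℝ}
    (hR : ∀ z, r z < R) (hR0 : 0 < R)
    (hr : ∀ c > 0, ∃ δ > 0, ∀ B ∈ β, ∀ z ∈ B, r z ≤ δ → ∀ y ∈ B, r y < c)
    {good : ℕ → Set Z → Prop} (hg0 : ∀ B ∈ β, good 0 B)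
    (hg : ∀ q, ∃ δ > 0, ∀ B ∈ β, ∀ z ∈ B, r z ≤ δ → good q B) :
    ∃ c : ℕ → ℝ, (∀ q, 0 < c q) ∧ StrictAnti c ∧ (∀ q, c (q + 1) ≤ 1 / ((q : ℝ) + 1)) ∧
      (∀ z, r z < c 0) ∧
      (∀ q, ∀ B ∈ β, ∀ z ∈ B, r z ≤ c (q + 1) → ∀ y ∈ B, r y < c q) ∧
      ∀ q, ∀ B ∈ β, ∀ z ∈ B, r z ≤ c q → good q B := by
  choose! f hf0 hf using hr
  choose g hg0' hg using hg
  let next : ℕ → ℝ → ℝ := fun q c => min (min (c / 2) (1 / ((q : ℝ) + 1))) (min (f c) (g (q + 1)))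
  let c : ℕ → ℝ := fun q => Nat.rec R next q
  have hpos : ∀ q, 0 < c q := by
    intro q
    induction q with
    | zero => exact hR0
    | succ q ih =>
      exact lt_min (lt_min (half_pos ih) (by positivity)) (lt_min (hf0 _ ih) (hg0' _))
  refine ⟨c, hpos, strictAnti_nat_of_succ_lt fun q => ?_, fun q => ?_, hR, fun q B hB z hz h => ?_,
    fun q B hB z hz h => ?_⟩
  · have : c (q + 1) ≤ c q / 2 := (min_le_left _ _).trans (min_le_left _ _)
    linarith [hpos q]
  · exact (min_le_left _ _).trans (min_le_right _ _)
  · exact hf _ (hpos q) B hB z hz (h.trans ((min_le_right _ _).trans (min_le_left _ _)))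
  · cases q with
    | zero => exact hg0 B hB
    | succ q => exact hg _ B hB z hz (h.trans ((min_le_right _ _).trans (min_le_right _ _)))

section Pack

variable {T : Type*} [MetricSpace T]

theorem IsUniformFam.exists_subset_ball {X : Set T} (hX : IsClosed X) (hne : X.Nonempty)
    {β : Set (Set T)} (h : IsUniformFam Xᶜ β) {ε : ℝ} (hε : 0 < ε) :
    ∃ δ > 0, ∀ B ∈ β, ∀ z ∈ B, infDist z X ≤ δ → B ⊆ ball z ε := by
  obtain ⟨K, hKX, hK, hd⟩ := h.2 ε hε
  obtain ⟨δ, hδ, hKδ⟩ : ∃ δ > 0, ∀ z ∈ K, δ < infDist z X := by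
    rcases K.eq_empty_or_nonempty with rfl | hKne
    · exact ⟨1, one_pos, by simp⟩
    · obtain ⟨z, hz, hmin⟩ := hK.exists_isMinOn hKne (continuous_infDist_pt X).continuousOn
      have hpos : 0 < infDist z X := (hX.notMem_iff_infDist_pos hne).1 (hKX hz)
      exact ⟨infDist z X / 2, half_pos hpos, fun w hw => by
        have : infDist z X ≤ infDist w X := hmin hw
        linarith⟩
  refine ⟨δ, hδ, fun B hB z hz hzδ y hy => ?_⟩
  refine hd (y, z) ⟨mem_biUnion hB ⟨hy, hz⟩, fun hmem => ?_⟩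
  exact absurd (hKδ z hmem.2) (not_lt.2 hzδ)

/-- A finite indexed family of open subsets of the ambient space covering `X`, no point
lying in more than `n + 1` members. -/
structure OrderedCover (X : Set T) (n : ℕ) where
  card : ℕ
  card_pos : 0 < card
  set : Fin card → Set T
  isOpen_set : ∀ i, IsOpen (set i)
  subset_iUnion : X ⊆ ⋃ i, set i
  card_le : ∀ (S : Finset (Fin card)) (z : T), (∀ i ∈ S, z ∈ set i) → S.card ≤ n + 1

/-- The one-member cover by the whole space. -/
def OrderedCover.trivial (X : Set T) (n : ℕ) : OrderedCover X n where
  card := 1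
  card_pos := one_pos
  set _ := univ
  isOpen_set _ := isOpen_univ
  subset_iUnion := fun x _ => mem_iUnion.2 ⟨0, mem_univ x⟩
  card_le S _ _ := (Finset.card_le_univ S).trans (by simp)

/-- The swelling of a subset `V` of `X` to the ambient space: the points strictly closer to `X`
than to `X \ V`. -/
def swelling (X V : Set T) : Set T := {z | infEDist z X < infEDist z (X \ V)}

theorem isOpen_swelling (X V : Set T) : IsOpen (swelling X V) :=
  isOpen_lt continuous_infEDist continuous_infEDist

theorem mem_swelling_of_isOpen {X : Set T} {V : Set X} (hV : IsOpen V) {x : X} (hx : x ∈ V) :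
    (x : T) ∈ swelling X (Subtype.val '' V) := by
  obtain ⟨O, hO, rfl⟩ := isOpen_induced_iff.1 hV
  have h0 : infEDist (x : T) X = 0 := infEDist_zero_of_mem x.2
  change infEDist (x : T) X < _
  rw [h0, pos_iff_ne_zero, Ne, ← mem_closure_iff_infEDist_zero]
  intro hcl
  obtain ⟨y, hyO, hyX, hy⟩ := mem_closure_iff.1 hcl O hO hx
  exact hy ⟨⟨y, hyX⟩, hyO, rfl⟩

theorem exists_mem_of_forall_mem_swelling {X : Set T} (hX : IsCompact X) (hne : X.Nonempty)
    (z : T) : ∃ x ∈ X, ∀ V, z ∈ swelling X V → x ∈ V := by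
  obtain ⟨x, hx, hxz⟩ := hX.exists_infEDist_eq_edist hne z
  refine ⟨x, hx, fun V hV => ?_⟩
  by_contra hxV
  have h1 : infEDist z (X \ V) ≤ edist z x := infEDist_le_edist_of_mem ⟨hx, hxV⟩
  rw [← hxz] at h1
  exact absurd hV (not_lt.2 h1)

theorem OrderedCover.exists_refinement [CompactSpace T] {X : Set T} (hX : IsClosed X)
    (hne : X.Nonempty) {n : ℕ} (hdim : DimLE X (n : ℤ)) (C : OrderedCover X n) {ε : ℝ}
    (hε : 0 < ε) :
    ∃ (D : OrderedCover X n) (π : Fin D.card → Fin C.card),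
      (∀ i, D.set i ⊆ C.set (π i)) ∧ ∀ i, ∀ a ∈ D.set i, ∀ b ∈ D.set i, dist a b < ε := by
  obtain ⟨lam, hlam, hleb⟩ :=
    lebesgue_number_lemma_of_metric hX.isCompact C.isOpen_set C.subset_iUnion
  set ρ := min lam (ε / 2) with hρ
  have hρ0 : 0 < ρ := lt_min hlam (half_pos hε)
  obtain ⟨t, htX, htf, htc⟩ := hX.isCompact.finite_cover_balls hρ0
  rcases hdim with ⟨hem, -⟩ | ⟨m, hm, hdim⟩
  · exact (hem.false ⟨_, hne.some_mem⟩).elim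
  obtain rfl : m = n := by exact_mod_cast hm
  obtain ⟨β, hβf, hβo, hβc, hβr, hβm⟩ := hdim ((fun x => Subtype.val ⁻¹' ball x ρ) '' t)
    (htf.image _) (by
      rintro _ ⟨x, -, rfl⟩
      exact isOpen_ball.preimage continuous_subtype_val) (by
      refine eq_univ_of_forall fun x => ?_
      obtain ⟨y, hy, hxy⟩ := mem_iUnion₂.1 (htc x.2)
      exact ⟨_, mem_image_of_mem _ hy, hxy⟩)
  have hcent : ∀ V ∈ β, ∃ x ∈ t, V ⊆ Subtype.val ⁻¹' ball x ρ := by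
    intro V hV
    obtain ⟨_, ⟨x, hx, rfl⟩, hVx⟩ := hβr V hV
    exact ⟨x, hx, hVx⟩
  have : Nonempty T := ⟨hne.some⟩
  have : Nonempty (Fin C.card) := ⟨⟨0, C.card_pos⟩⟩
  choose! cent hct hcs using hcent
  choose! par hpar using hleb
  have : Finite β := hβf
  obtain ⟨N, ⟨e⟩⟩ := Finite.exists_equiv_fin β
  refine ⟨⟨N, ?_, fun i => swelling X (Subtype.val '' (e.symm i).1) ∩ ball (cent (e.symm i).1) ρ,
    fun i => (isOpen_swelling _ _).inter isOpen_ball, ?_, ?_⟩,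
    fun i => par (cent (e.symm i).1), ?_, ?_⟩
  · obtain ⟨x, hx⟩ := hne
    obtain ⟨V, hV, -⟩ : (⟨x, hx⟩ : X) ∈ ⋃₀ β := hβc ▸ mem_univ _
    exact Fin.pos (e ⟨V, hV⟩)
  · intro x hx
    obtain ⟨V, hV, hxV⟩ : (⟨x, hx⟩ : X) ∈ ⋃₀ β := hβc ▸ mem_univ _
    refine mem_iUnion.2 ⟨e ⟨V, hV⟩, ?_⟩
    simp only [Equiv.symm_apply_apply]
    exact ⟨mem_swelling_of_isOpen (hβo V hV) hxV, hcs V hV hxV⟩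
  · intro S z hz
    obtain ⟨x, hx, hxV⟩ := exists_mem_of_forall_mem_swelling hX.isCompact hne z
    have hinj : Function.Injective fun i => (e.symm i).1 :=
      Subtype.val_injective.comp e.symm.injective
    rw [← Finset.card_map ⟨_, hinj⟩]
    refine hβm _ ?_ ⟨⟨x, hx⟩, ?_⟩
    · intro V hV
      obtain ⟨i, -, rfl⟩ := Finset.mem_map.1 (Finset.mem_coe.1 hV)
      exact (e.symm i).2
    · rintro V hV
      obtain ⟨i, hi, rfl⟩ := Finset.mem_map.1 (Finset.mem_coe.1 hV)
      obtain ⟨y, hy, hyx⟩ := hxV _ (hz i hi).1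
      have : y = ⟨x, hx⟩ := Subtype.ext hyx
      exact this ▸ hy
  · intro i
    refine inter_subset_right.trans ((ball_subset_ball (min_le_left _ _)).trans ?_)
    exact hpar _ (htX (hct _ (e.symm i).2))
  · intro i a ha b hb
    have h1 := mem_ball.1 ha.2
    have h2 := mem_ball.1 hb.2
    have h3 : ρ ≤ ε / 2 := min_le_right _ _
    have h4 := dist_triangle_right a b (cent (e.symm i).1)
    linarith

theorem OrderedCover.exists_sequence [CompactSpace T] {X : Set T} (hX : IsClosed X)
    (hne : X.Nonempty) {n : ℕ} (hdim : DimLE X (n : ℤ)) :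
    ∃ (s : ℕ → OrderedCover X n) (π : ∀ k, Fin (s (k + 1)).card → Fin (s k).card),
      (s 0).card = 1 ∧ (∀ j, (s 1).set j = univ) ∧
      (∀ k i, (s (k + 1)).set i ⊆ (s k).set (π k i)) ∧
      ∀ k i, ∀ a ∈ (s (k + 2)).set i, ∀ b ∈ (s (k + 2)).set i, dist a b < 1 / ((k : ℝ) + 1) := by
  choose next par hsub hdist using fun (k : ℕ) (C : OrderedCover X n) =>
    C.exists_refinement hX hne hdim (ε := 1 / ((k : ℝ) + 1)) (by positivity)
  let s : ℕ → OrderedCover X n := fun k => Nat.rec (.trivial X n) (fun k C => next k C) k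
  let s' : ℕ → OrderedCover X n := fun k => Nat.casesOn k (.trivial X n) s
  refine ⟨s', fun k => match k with
    | 0 => id
    | k + 1 => par k (s k), rfl, fun _ => rfl, ?_, ?_⟩
  · rintro (_ | k) i
    · exact subset_rfl
    · exact hsub k (s k) i
  · intro k i
    exact hdist k (s k) i

theorem MultLE.range {Z ι : Type*} {A : ι → Set Z} {m : ℕ}
    (h : ∀ (z : Z) (S : Finset ι), (∀ i ∈ S, z ∈ A i) → S.card ≤ m) : MultLE (range A) m := by
  classical
  rintro S hS ⟨z, hz⟩
  rcases S.eq_empty_or_nonempty with rfl | ⟨U₀, hU₀⟩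
  · simp
  obtain ⟨i₀, -⟩ := hS hU₀
  have : Nonempty ι := ⟨i₀⟩
  have hex : ∀ U ∈ S, ∃ i, A i = U := fun U hU => hS hU
  choose! f hf using hex
  rw [← Finset.card_image_of_injOn (f := f) (s := S) fun U hU V hV hUV => by
    rw [← hf U hU, ← hf V hV]; exact congrArg A hUV]
  refine h z _ fun i hi => ?_
  obtain ⟨U, hU, rfl⟩ := Finset.mem_image.1 hi
  rw [hf U hU]
  exact hz U hU

theorem IsCanonicalCover.of_isUniformFam {X : Set T} {α : Set (Set T)}
    (ho : ∀ U ∈ α, IsOpen U) (hc : ⋃₀ α = Xᶜ) (hl : LocallyFiniteIn Xᶜ α)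
    (hu : IsUniformFam Xᶜ α) : IsCanonicalCover X α := by
  refine ⟨fun U hU => ⟨ho U hU, hc ▸ subset_sUnion_of_mem hU⟩, hc, hl, fun x hx V hV => ?_⟩
  obtain ⟨ε, hε, hεV⟩ := Metric.mem_nhds_iff.1 hV
  obtain ⟨K, hKX, hK, hd⟩ := hu.2 (ε / 2) (half_pos hε)
  refine ⟨ball x (ε / 2) ∩ Kᶜ, inter_mem (ball_mem_nhds _ (half_pos hε))
    (hK.isClosed.isOpen_compl.mem_nhds fun h => hKX h hx), ?_⟩
  rintro y ⟨U, ⟨hU, w, hwU, ⟨hwx, hwK⟩, -⟩, hy⟩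
  refine hεV (mem_ball.2 ?_)
  have h1 : dist y w < ε / 2 :=
    hd (y, w) ⟨mem_biUnion hU ⟨hy, hwU⟩, fun h => hwK h.2⟩
  have h2 := mem_ball.1 hwx
  linarith [dist_triangle y w x]

theorem IsCanonicalCover.isUniformCover [CompactSpace T] {X : Set T} (hX : IsClosed X)
    {α : Set (Set T)} (h : IsCanonicalCover X α) : IsUniformCover Xᶜ α := by
  obtain ⟨ho, hc, -, hn⟩ := h
  refine ⟨⟨iUnion₂_subset fun U hU => prod_mono (ho U hU).2 (ho U hU).2, fun ε hε => ?_⟩, hc⟩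
  choose! W hW hWb using fun x hx => hn x hx (ball x (ε / 2)) (ball_mem_nhds x (half_pos hε))
  obtain ⟨t, htc⟩ := hX.isCompact.elim_nhds_subcover' (fun x _ => interior (W x))
    fun x hx => interior_mem_nhds.2 (hW x hx)
  have key : ∀ y z, ∀ U ∈ α, y ∈ U → z ∈ U → y ∉ (⋃ x ∈ t, interior (W x.1))ᶜ →
      dist y z < ε := by
    intro y z U hU hy hz hyK
    obtain ⟨x, hx, hyx⟩ := mem_iUnion₂.1 (not_not.1 hyK)
    have hsub : U ⊆ ball x.1 (ε / 2) := fun u hu => hWb x.1 x.2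
      ⟨U, ⟨hU, y, hy, interior_subset hyx, (ho U hU).2 hy⟩, hu⟩
    have h1 := mem_ball.1 (hsub hy)
    have h2 := mem_ball.1 (hsub hz)
    linarith [dist_triangle_right y z x.1]
  refine ⟨(⋃ x ∈ t, interior (W x.1))ᶜ, compl_subset_compl.2 htc,
    (isOpen_biUnion fun _ _ => isOpen_interior).isClosed_compl.isCompact, ?_⟩
  rintro ⟨y, z⟩ ⟨hyz, hK⟩
  obtain ⟨U, hU, hy, hz⟩ := mem_iUnion₂.1 hyz
  by_cases hyK : y ∈ (⋃ x ∈ t, interior (W x.1))ᶜ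
  · rw [dist_comm]
    exact key z y U hU hz hy fun hzK => hK ⟨hyK, hzK⟩
  · exact key y z U hU hy hz hyK

theorem exists_isCanonicalCover_of_dimLE [CompactSpace T] {X : Set T} (hX : IsClosed X)
    (hne : X.Nonempty) {n : ℕ} (hdim : DimLE X (n : ℤ)) {β : Set (Set T)}
    (hβ : IsUniformCover Xᶜ β) :
    ∃ α : Set (Set T), IsCanonicalCover X α ∧ Refines β α ∧ MultLE α (n + 2) := by
  classical
  obtain ⟨s, π, hs0, hs1, hπ, hmesh⟩ := OrderedCover.exists_sequence hX hne hdim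
  set r : T → ℝ := fun z => infDist z X with hr
  have hrc : Continuous r := continuous_infDist_pt X
  have hr0 : ∀ z, 0 < r z ↔ z ∈ Xᶜ := fun z => (hX.notMem_iff_infDist_pos hne).symm
  obtain ⟨R, hR0, hR⟩ : ∃ R, 0 < R ∧ ∀ z, r z < R := by
    obtain ⟨R, hR⟩ := isCompact_univ.bddAbove_image hrc.continuousOn
    refine ⟨|R| + 1, by positivity, fun z => ?_⟩
    have : r z ≤ R := hR (mem_image_of_mem r (mem_univ z))
    linarith [le_abs_self R]
  have hball : ∀ c > 0, ∃ δ > 0, ∀ B ∈ β, ∀ z ∈ B, r z ≤ δ → ∀ y ∈ B, r y < c := by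
    intro c hc
    obtain ⟨δ, hδ, h⟩ := hβ.1.exists_subset_ball hX hne (half_pos hc)
    refine ⟨min δ (c / 2), lt_min hδ (half_pos hc), fun B hB z hz hzδ y hy => ?_⟩
    have h1 := mem_ball.1 (h B hB z hz (hzδ.trans (min_le_left _ _)) hy)
    have h2 : r y ≤ r z + dist y z := infDist_le_infDist_add_dist
    linarith [min_le_right δ (c / 2)]
  have hgood : ∀ q, ∃ δ > 0, ∀ B ∈ β, ∀ z ∈ B, r z ≤ δ → ∃ j, B ⊆ (s (q + 1)).set j := by
    intro q
    obtain ⟨lam, hlam, hleb⟩ := lebesgue_number_lemma_of_metric hX.isCompact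
      (s (q + 1)).isOpen_set (s (q + 1)).subset_iUnion
    obtain ⟨δ, hδ, h⟩ := hβ.1.exists_subset_ball hX hne (half_pos hlam)
    refine ⟨min δ (lam / 3), lt_min hδ (by positivity), fun B hB z hz hzδ => ?_⟩
    obtain ⟨x, hx, hxz⟩ := hX.isCompact.exists_infDist_eq_dist hne z
    obtain ⟨j, hj⟩ := hleb x hx
    refine ⟨j, Subset.trans (fun y hy => mem_ball.2 ?_) hj⟩
    have h1 := mem_ball.1 (h B hB z hz (hzδ.trans (min_le_left _ _)) hy)
    have h2 : dist z x ≤ lam / 3 := by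
      rw [← hxz]
      exact hzδ.trans (min_le_right _ _)
    linarith [dist_triangle y z x]
  obtain ⟨c, hc0, hca, hc1, hcR, hcB, hcg⟩ := exists_levels (good := fun q B =>
    ∃ j, B ⊆ (s (q + 1)).set j) hR hR0 hball
    (fun B _ => ⟨⟨0, (s 1).card_pos⟩, by rw [hs1]; exact subset_univ B⟩) hgood
  let P : ℕ → ℕ := fun k => ∑ l ∈ Finset.range k, (s l).card
  have hPs : ∀ k, P (k + 1) = P k + (s k).card := fun k => Finset.sum_range_succ _ _
  have hPm : StrictMono P := strictMono_nat_of_lt_succ fun k => by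
    have := (s k).card_pos
    rw [hPs]; omega
  have hPle : ∀ k, k ≤ P k := fun k => hPm.le_apply
  have hex : ∀ z, 0 < r z → ∃ q, c q < r z := by
    intro z hz
    obtain ⟨q, hq⟩ := exists_nat_one_div_lt hz
    exact ⟨q + 1, (hc1 q).trans_lt hq⟩
  let A : (Σ k, Fin (s k).card) → Set T := fun q =>
    {z | r z < c (P q.1 + q.2) ∧ ∃ i, π q.1 i = q.2 ∧ z ∈ (s (q.1 + 1)).set i ∧
      c (P (q.1 + 1) + i + 1) < r z}
  have hAW : ∀ q, A q ⊆ (s q.1).set q.2 := by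
    rintro ⟨k, j⟩ z ⟨-, i, hij, hzi, -⟩
    exact hij ▸ hπ k i hzi
  have hAr : ∀ q, ∀ z ∈ A q, c (P (q.1 + 2)) < r z := by
    rintro ⟨k, j⟩ z ⟨-, i, -, -, hi⟩
    refine lt_of_le_of_lt (hca.antitone ?_) hi
    have := hPs (k + 1)
    have := i.2
    dsimp only at this
    change P (k + 1) + i + 1 ≤ P (k + 1 + 1)
    omega
  have hAo : ∀ q, IsOpen (A q) := by
    intro q
    have : A q = {z | r z < c (P q.1 + q.2)} ∩ ⋃ i : {i // π q.1 i = q.2},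
        (s (q.1 + 1)).set i ∩ {z | c (P (q.1 + 1) + i + 1) < r z} := by
      ext z
      simp [A, and_left_comm]
    rw [this]
    exact (isOpen_lt hrc continuous_const).inter (isOpen_iUnion fun i =>
      ((s (q.1 + 1)).isOpen_set i).inter (isOpen_lt continuous_const hrc))
  have hAX : ∀ q, A q ⊆ Xᶜ := fun q z hz => (hr0 z).1 ((hc0 _).trans (hAr q z hz))
  have hchain : ∀ B ∈ β, ∀ k (j : Fin (s (k + 1)).card), B ⊆ (s (k + 1)).set j →
      (∀ y ∈ B, c (P (k + 1) + j + 1) < r y) → ∃ q, B ⊆ A q := by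
    intro B hB k
    induction k with
    | zero =>
      intro j hBj hr
      refine ⟨⟨0, π 0 j⟩, fun y hy => ⟨?_, j, rfl, hBj hy, hr y hy⟩⟩
      have h0 : ((π 0 j : Fin (s 0).card) : ℕ) = 0 := by
        have := (π 0 j).2
        omega
      simpa [P, h0] using hcR y
    | succ k ih =>
      intro j hBj hr
      by_cases hB' : ∀ y ∈ B, c (P (k + 1) + π (k + 1) j + 1) < r y
      · exact ih _ (hBj.trans (hπ _ j)) hB'
      · push Not at hB'
        obtain ⟨z, hz, hzr⟩ := hB'
        exact ⟨⟨k + 1, π (k + 1) j⟩, fun y hy =>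
          ⟨hcB _ B hB z hz hzr y hy, j, rfl, hBj hy, hr y hy⟩⟩
  have href : Refines β (range A) := by
    intro B hB
    rcases B.eq_empty_or_nonempty with rfl | ⟨y₀, hy₀⟩
    · exact ⟨_, mem_range_self ⟨0, ⟨0, (s 0).card_pos⟩⟩, empty_subset _⟩
    have hBX : B ⊆ Xᶜ := hβ.2 ▸ subset_sUnion_of_mem hB
    have hexq : ∃ q, ∀ y ∈ B, c (q + 1) < r y := by
      obtain ⟨q, hq⟩ := hex y₀ ((hr0 y₀).2 (hBX hy₀))
      refine ⟨q, fun y hy => ?_⟩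
      by_contra! h
      exact absurd (hcB q B hB y hy h y₀ hy₀) (not_lt.2 hq.le)
    have hlow : ∃ z ∈ B, r z ≤ c (Nat.find hexq) := by
      rcases Nat.eq_zero_or_pos (Nat.find hexq) with h0 | h0
      · exact ⟨y₀, hy₀, by rw [h0]; exact (hcR y₀).le⟩
      · have := Nat.find_min hexq (Nat.sub_lt h0 one_pos)
        push Not at this
        rwa [show Nat.find hexq - 1 + 1 = Nat.find hexq by omega] at this
    obtain ⟨z, hz, hzr⟩ := hlow
    obtain ⟨j, hj⟩ := hcg _ B hB z hz hzr
    obtain ⟨q, hq⟩ := hchain B hB _ j hj fun y hy => by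
      refine lt_of_le_of_lt (hca.antitone ?_) (Nat.find_spec hexq y hy)
      have := hPle (Nat.find hexq + 1)
      omega
    exact ⟨A q, mem_range_self q, hq⟩
  refine ⟨range A, .of_isUniformFam (forall_mem_range.2 hAo) ?_ ?_ ⟨?_, ?_⟩, href,
    MultLE.range ?_⟩
  · refine Subset.antisymm (sUnion_subset (forall_mem_range.2 hAX)) fun z hz => ?_
    obtain ⟨B, hB, hzB⟩ : z ∈ ⋃₀ β := hβ.2 ▸ hz
    obtain ⟨U, hU, hBU⟩ := href B hB
    exact ⟨U, hU, hBU hzB⟩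
  · intro z hz
    obtain ⟨q₀, hq₀⟩ := hex z ((hr0 z).2 hz)
    refine ⟨{y | c q₀ < r y}, isOpen_lt continuous_const hrc, hq₀, ?_⟩
    refine ((finite_iUnion fun k : Fin q₀ =>
      finite_range fun j : Fin (s k).card => A ⟨k, j⟩)).subset ?_
    rintro _ ⟨⟨⟨k, j⟩, rfl⟩, y, ⟨hy1, -⟩, hy2⟩
    have h1 : P k + j < q₀ := hca.lt_iff_gt.1 (lt_trans hy2 hy1)
    have h2 := hPle k
    exact mem_iUnion.2 ⟨⟨k, by omega⟩, mem_range_self j⟩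
  · exact iUnion₂_subset (forall_mem_range.2 fun q => prod_mono (hAX q) (hAX q))
  · intro ε hε
    obtain ⟨k, hk⟩ := exists_nat_one_div_lt hε
    refine ⟨{z | c (P (k + 4)) ≤ r z}, fun z hz => (hr0 z).1 ((hc0 _).trans_le hz),
      (isClosed_le continuous_const hrc).isCompact, ?_⟩
    rintro ⟨y, z⟩ ⟨hyz, hK⟩
    obtain ⟨_, ⟨⟨l, j⟩, rfl⟩, hy, hz⟩ := mem_iUnion₂.1 hyz
    by_cases hl : l ≤ k + 2
    · have hle : c (P (k + 4)) ≤ c (P (l + 2)) := hca.antitone (hPm.monotone (by omega))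
      exact (hK ⟨hle.trans (hAr _ _ hy).le, hle.trans (hAr _ _ hz).le⟩).elim
    · obtain ⟨l, rfl⟩ : ∃ l', l = l' + 2 := ⟨l - 2, by omega⟩
      refine (hmesh l j y (hAW _ hy) z (hAW _ hz)).trans_le (le_trans ?_ hk.le)
      have : (k : ℝ) ≤ l := by exact_mod_cast (by omega : k ≤ l)
      exact one_div_le_one_div_of_le (by positivity) (by linarith)
  · intro z Q hQ
    rcases Q.eq_empty_or_nonempty with rfl | ⟨q₀, hq₀⟩
    · simp
    have hexk : ∃ k, c (P k) ≤ r z := by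
      obtain ⟨q, hq⟩ := hex z ((hc0 _).trans (hAr q₀ z (hQ q₀ hq₀)))
      exact ⟨q, (hca.antitone (hPle q)).trans hq.le⟩
    have hk0 : Nat.find hexk ≠ 0 := by
      intro h0
      have := Nat.find_spec hexk
      rw [h0] at this
      exact absurd (hcR z) (not_lt.2 this)
    obtain ⟨K, hK⟩ := Nat.exists_eq_succ_of_ne_zero hk0
    have hK1 : c (P (K + 1)) ≤ r z := by
      have := Nat.find_spec hexk
      rwa [hK] at this
    have hK2 : r z < c (P K) := not_le.1 (Nat.find_min hexk (by omega))
    have hlayer : ∀ q ∈ Q, q.1 = K ∨ q.1 + 1 = K := by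
      intro q hq
      have h1 : P q.1 + q.2 < P (K + 1) := hca.lt_iff_gt.1 (hK1.trans_lt (hQ q hq).1)
      have h2 : P K < P (q.1 + 2) := hca.lt_iff_gt.1 ((hAr q z (hQ q hq)).trans hK2)
      have h3 : q.1 < K + 1 := hPm.lt_iff_lt.1 (by omega)
      have h4 := hPm.lt_iff_lt.1 h2
      omega
    let S₁ : Finset (Fin (s K).card) :=
      Finset.univ.filter fun i => z ∈ (s K).set i ∧ r z < c (P K + i)
    let S₂ : Finset (Fin (s K).card) :=
      Finset.univ.filter fun i => z ∈ (s K).set i ∧ c (P K + i + 1) < r z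
    have hunion : (S₁ ∪ S₂).card ≤ n + 1 := by
      refine (s K).card_le _ z fun i hi => ?_
      rcases Finset.mem_union.1 hi with h | h
      · exact (Finset.mem_filter.1 h).2.1
      · exact (Finset.mem_filter.1 h).2.1
    have hinter : (S₁ ∩ S₂).card ≤ 1 := by
      refine Finset.card_le_one.2 fun i hi j hj => ?_
      simp only [S₁, S₂, Finset.mem_inter, Finset.mem_filter, Finset.mem_univ, true_and] at hi hj
      have h1 := hca.lt_iff_gt.1 (hi.2.2.trans hj.1.2)
      have h2 := hca.lt_iff_gt.1 (hj.2.2.trans hi.1.2)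
      exact Fin.ext (by omega)
    have hQ₁ : (Q.filter fun q => q.1 = K).card ≤ S₁.card := by
      refine (Finset.card_le_card (t := S₁.image (Sigma.mk K)) ?_).trans Finset.card_image_le
      rintro ⟨k, j⟩ hq
      obtain ⟨hqQ, rfl⟩ := Finset.mem_filter.1 hq
      exact Finset.mem_image.2 ⟨j, Finset.mem_filter.2
        ⟨Finset.mem_univ _, hAW _ (hQ _ hqQ), (hQ _ hqQ).1⟩, rfl⟩
    have hQ₂ : (Q.filter fun q => ¬ q.1 = K).card ≤ S₂.card := by
      rcases Nat.eq_zero_or_pos K with rfl | hKpos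
      · rw [Finset.card_eq_zero.2 (Finset.filter_eq_empty_iff.2 fun q hq => by
          have := hlayer q hq
          omega)]
        exact Nat.zero_le _
      obtain ⟨L, rfl⟩ := Nat.exists_eq_succ_of_ne_zero hKpos.ne'
      refine (Finset.card_le_card
        (t := S₂.image fun i => (⟨L, π L i⟩ : Σ k, Fin (s k).card)) ?_).trans
        Finset.card_image_le
      rintro ⟨k, j⟩ hq
      obtain ⟨hqQ, hqK⟩ := Finset.mem_filter.1 hq
      obtain rfl : k = L := by
        have := hlayer _ hqQ
        simp only at this hqK
        omega
      obtain ⟨-, i, hij, hzi, hi⟩ := hQ _ hqQ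
      exact Finset.mem_image.2 ⟨i, Finset.mem_filter.2 ⟨Finset.mem_univ _, hzi, hi⟩, by
        simp only at hij
        rw [hij]⟩
    have h1 := Finset.card_filter_add_card_filter_not (s := Q) fun q => q.1 = K
    have h2 := Finset.card_union_add_card_inter S₁ S₂
    omega

theorem isUniformFam_compl_empty [CompactSpace T] (α : Set (Set T)) :
    IsUniformFam (∅ : Set T)ᶜ α := by
  refine ⟨by simp, fun ε hε => ⟨univ, by simp, isCompact_univ, ?_⟩⟩
  rintro p ⟨-, hp⟩
  exact (hp (by simp)).elim

theorem isCanonicalCover_singleton_univ [CompactSpace T] :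
    IsCanonicalCover (∅ : Set T) {univ} :=
  .of_isUniformFam (by simp) (by simp)
    (fun _ _ => ⟨univ, isOpen_univ, mem_univ _, (finite_singleton _).subset (sep_subset _ _)⟩)
    (isUniformFam_compl_empty _)

theorem multLE_singleton {Z : Type*} (U : Set Z) (m : ℕ) : MultLE {U} (m + 1) := by
  intro S hS _
  refine (Finset.card_le_card (t := {U}) fun V hV => ?_).trans (by simp)
  simpa using hS hV

theorem exists_isCanonicalCover [CompactSpace T] {X : Set T} (hX : IsClosed X) :
    ∃ α, IsCanonicalCover X α := by
  rcases X.eq_empty_or_nonempty with rfl | hne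
  · exact ⟨_, isCanonicalCover_singleton_univ⟩
  have hpos : ∀ x ∈ Xᶜ, 0 < infDist x X := fun x hx => (hX.notMem_iff_infDist_pos hne).1 hx
  obtain ⟨v, hvo, hvc, hvl, hvs⟩ := precise_refinement
    (fun x : (Xᶜ : Set T) => ball x (infDist (x : T) X / 2)) (fun _ => isOpen_ball)
    (eq_univ_of_forall fun x => mem_iUnion.2 ⟨x, mem_ball_self (half_pos (hpos x x.2))⟩)
  refine ⟨range fun i => Subtype.val '' v i, .of_isUniformFam
    (forall_mem_range.2 fun i => hX.isOpen_compl.isOpenMap_subtype_val _ (hvo i)) ?_ ?_ ⟨?_, ?_⟩⟩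
  · rw [sUnion_range, ← image_iUnion, hvc, image_univ, Subtype.range_coe]
  · intro x hx
    obtain ⟨t, ht, htf⟩ := hvl ⟨x, hx⟩
    obtain ⟨O, hOt, hO, hxO⟩ := _root_.mem_nhds_iff.1 ht
    refine ⟨Subtype.val '' O, hX.isOpen_compl.isOpenMap_subtype_val _ hO, ⟨_, hxO, rfl⟩,
      (htf.image fun i => Subtype.val '' v i).subset ?_⟩
    rintro _ ⟨⟨i, rfl⟩, _, ⟨y, hy, rfl⟩, ⟨z, hz, hzy⟩⟩
    obtain rfl := Subtype.ext hzy
    exact ⟨i, ⟨z, hy, hOt hz⟩, rfl⟩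
  · exact iUnion₂_subset (forall_mem_range.2 fun i =>
      prod_mono (Subtype.coe_image_subset _ _) (Subtype.coe_image_subset _ _))
  · intro ε hε
    refine ⟨{z | ε / 2 ≤ infDist z X}, fun z hz =>
      (hX.notMem_iff_infDist_pos hne).2 ((half_pos hε).trans_le hz),
      (isClosed_le continuous_const (continuous_infDist_pt X)).isCompact, ?_⟩
    have key : ∀ (x : (Xᶜ : Set T)) (y z : T), y ∈ ball (x : T) (infDist (x : T) X / 2) →
        z ∈ ball (x : T) (infDist (x : T) X / 2) → infDist y X < ε / 2 → dist y z < ε := by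
      intro x y z hy hz h
      rw [mem_ball] at hy hz
      have h1 : infDist (x : T) X ≤ infDist y X + dist (x : T) y := infDist_le_infDist_add_dist
      rw [dist_comm] at h1
      linarith [dist_triangle_right y z x]
    rintro ⟨y, z⟩ ⟨hyz, hK⟩
    obtain ⟨_, ⟨i, rfl⟩, ⟨y, hy, rfl⟩, ⟨z, hz, rfl⟩⟩ := mem_iUnion₂.1 hyz
    by_cases h : infDist (y : T) X < ε / 2
    · exact key i y z (hvs i hy) (hvs i hz) h
    · rw [dist_comm]
      exact key i z y (hvs i hz) (hvs i hy) (not_le.1 fun h' => hK ⟨not_lt.1 h, h'⟩)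

theorem IsUniformCover.exists_isOpen {X : Set T} {α β : Set (Set T)}
    (hα : IsUniformCover Xᶜ α) (hβ : ∀ U ∈ β, IsOpen U) (hβc : ⋃₀ β = Xᶜ) (hr : Refines β α)
    {m : ℕ} (hm : MultLE α m) :
    ∃ γ : Set (Set T), (∀ U ∈ γ, IsOpen U) ∧ IsUniformCover Xᶜ γ ∧ MultLE γ m := by
  let f : Set T → Set T := fun U => ⋃₀ {V ∈ β | V ⊆ U}
  have hf : ∀ U, f U ⊆ U := fun U => sUnion_subset fun V hV => hV.2
  refine ⟨range fun U : α => f U, forall_mem_range.2 fun U =>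
    isOpen_sUnion fun V hV => hβ V hV.1, ⟨⟨?_, fun ε hε => ?_⟩, ?_⟩, MultLE.range ?_⟩
  · exact iUnion₂_subset (forall_mem_range.2 fun U =>
      (prod_mono (hf U) (hf U)).trans ((subset_biUnion_of_mem (u := fun U => U ×ˢ U) U.2).trans hα.1.1))
  · obtain ⟨K, hKX, hK, hd⟩ := hα.1.2 ε hε
    refine ⟨K, hKX, hK, fun p hp => hd p ⟨?_, hp.2⟩⟩
    obtain ⟨_, ⟨U, rfl⟩, hpU⟩ := mem_iUnion₂.1 hp.1
    exact mem_biUnion U.2 (prod_mono (hf U) (hf U) hpU)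
  · refine Subset.antisymm (sUnion_subset (forall_mem_range.2 fun U =>
      (hf U).trans (hα.2 ▸ subset_sUnion_of_mem U.2))) ?_
    rw [← hβc]
    refine sUnion_subset fun V hV => ?_
    obtain ⟨U, hU, hVU⟩ := hr V hV
    exact fun x hx => ⟨_, mem_range_self ⟨U, hU⟩, V, ⟨hV, hVU⟩, hx⟩
  · intro z S hS
    rw [← Finset.card_map (Function.Embedding.subtype _)]
    refine hm _ ?_ ⟨z, ?_⟩
    · intro V hV
      obtain ⟨U, -, rfl⟩ := Finset.mem_map.1 (Finset.mem_coe.1 hV)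
      exact U.2
    · intro V hV
      obtain ⟨U, hU, rfl⟩ := Finset.mem_map.1 (Finset.mem_coe.1 hV)
      exact hf _ (hS U hU)

end Pack

section ThinCovers

/-- Finite open covers of `Y × [0, 1]` with multiplicity at most `m + 1`, with members of small
projection to `Y`, none of which meets both ends of the cylinder. -/
def HasThinCovers (Y : Type*) [MetricSpace Y] (m : ℕ) : Prop :=
  ∀ ε > 0, ∃ (N : ℕ) (O : Fin N → Set (Y × unitInterval)),
    (∀ i, IsOpen (O i)) ∧ (∀ p, ∃ i, p ∈ O i) ∧
    (∀ p (S : Finset (Fin N)), (∀ i ∈ S, p ∈ O i) → S.card ≤ m + 1) ∧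
    (∀ i, ∀ p ∈ O i, ∀ q ∈ O i, dist p.1 q.1 < ε) ∧
    ∀ i, ∀ p ∈ O i, ∀ q ∈ O i, p.2 = 0 → q.2 ≠ 1

theorem exists_forall_dist_lt_of_injective {Y Z : Type*} [MetricSpace Y] [CompactSpace Y]
    [MetricSpace Z] {j : Y → Z} (hj : Continuous j) (hinj : Function.Injective j) {ε : ℝ}
    (hε : 0 < ε) : ∃ δ > 0, ∀ p q, dist (j p) (j q) < δ → dist p q < ε := by
  have hK : IsCompact {p : Y × Y | ε ≤ dist p.1 p.2} :=
    (isClosed_le continuous_const continuous_dist).isCompact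
  rcases eq_empty_or_nonempty {p : Y × Y | ε ≤ dist p.1 p.2} with he | hne
  · refine ⟨1, one_pos, fun p q _ => not_le.1 fun h => ?_⟩
    exact (he ▸ (show (p, q) ∈ {p : Y × Y | ε ≤ dist p.1 p.2} from h) : (p, q) ∈ (∅ : Set (Y × Y)))
  · obtain ⟨z, hz, hmin⟩ := hK.exists_isMinOn hne
      (f := fun p : Y × Y => dist (j p.1) (j p.2)) (by fun_prop)
    refine ⟨dist (j z.1) (j z.2), dist_pos.2 fun h => ?_, fun p q hpq => not_le.1 fun h => ?_⟩
    · have hz' : ε ≤ dist z.1 z.2 := hz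
      rw [hinj h, dist_self] at hz'
      linarith
    · exact absurd (hmin (show (p, q) ∈ {p : Y × Y | ε ≤ dist p.1 p.2} from h)) (not_le.2 hpq)

theorem IsUniformFam.exists_level {T : Type*} [MetricSpace T] [CompactSpace T] {X : Set T}
    (hX : IsClosed X) {α : Set (Set T)} (hα : IsUniformFam Xᶜ α)
    {j : X × unitInterval → T} (hj : IsEmbedding j) (hj0 : ∀ x : X, j (x, 0) = x)
    {ε : ℝ} (hε : 0 < ε) : ∃ t > 0, ∀ U ∈ α, ∀ p q, j p ∈ U → j q ∈ U → (p.2 : ℝ) ≤ t →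
      dist p q < ε := by
  have : CompactSpace X := isCompact_iff_compactSpace.1 hX.isCompact
  rcases X.eq_empty_or_nonempty with rfl | hne
  · exact ⟨1, one_pos, fun U _ p => absurd p.1.2 (notMem_empty _)⟩
  obtain ⟨δ, hδ, hδj⟩ := exists_forall_dist_lt_of_injective hj.continuous hj.injective hε
  obtain ⟨η, hη, hηα⟩ := hα.exists_subset_ball hX hne hδ
  obtain ⟨t, ht, htj⟩ := Metric.uniformContinuous_iff.1
    (CompactSpace.uniformContinuous_of_continuous hj.continuous) η hη
  refine ⟨t / 2, half_pos ht, fun U hU p q hp hq hpt => hδj p q ?_⟩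
  have hinf : infDist (j p) X ≤ η := by
    have h0 : dist p (p.1, (0 : unitInterval)) < t := by
      have : dist p.2 (0 : unitInterval) = p.2 := by
        rw [Subtype.dist_eq, Real.dist_eq]
        simp [abs_of_nonneg p.2.2.1]
      rw [Prod.dist_eq, dist_self, this]
      exact max_lt ht (by linarith)
    have := htj h0
    rw [hj0] at this
    exact (infDist_le_dist_of_mem p.1.2).trans this.le
  have := hηα U hU _ hp hinf hq
  rwa [mem_ball, dist_comm] at this

theorem IsUniformCover.hasThinCovers {T : Type*} [MetricSpace T] [CompactSpace T] {X : Set T}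
    (hX : IsClosed X) (hcyl : IsCylindrical T X) {α : Set (Set T)} (hαo : ∀ U ∈ α, IsOpen U)
    (hα : IsUniformCover Xᶜ α) {m : ℕ} (hm : MultLE α (m + 1)) : HasThinCovers X m := by
  have : CompactSpace X := isCompact_iff_compactSpace.1 hX.isCompact
  obtain ⟨j, hj, hj0⟩ := hcyl
  intro ε hε
  obtain ⟨t₁, ht₁, h₁⟩ := hα.1.exists_level hX hj hj0 hε
  obtain ⟨a, ha, ha1, hat⟩ : ∃ a > 0, a ≤ 1 ∧ a ≤ t₁ :=
    ⟨min 1 t₁, lt_min one_pos ht₁, min_le_left _ _, min_le_right _ _⟩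
  obtain ⟨t₂, ht₂, h₂⟩ := hα.1.exists_level hX hj hj0 (half_pos ha)
  obtain ⟨b, hb, hba, hbt⟩ : ∃ b > 0, b ≤ a / 2 ∧ b ≤ t₂ :=
    ⟨min (a / 2) t₂, lt_min (half_pos ha) ht₂, min_le_left _ _, min_le_right _ _⟩
  have hlev : ∀ s : unitInterval, 0 < b + (a - b) * s ∧ b + (a - b) * s ≤ a := fun s =>
    ⟨by nlinarith [s.2.1, s.2.2], by nlinarith [s.2.1, s.2.2]⟩
  let w : X × unitInterval → X × unitInterval := fun p =>
    (p.1, ⟨b + (a - b) * p.2, (hlev p.2).1.le, (hlev p.2).2.trans ha1⟩)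
  have hw : Continuous w := by fun_prop
  have hwX : ∀ p, j (w p) ∈ Xᶜ := fun p hp => by
    have h := hj.injective (a₁ := w p) (a₂ := (⟨_, hp⟩, 0)) (hj0 ⟨_, hp⟩).symm
    have h' := congrArg (fun q : X × unitInterval => (q.2 : ℝ)) h
    exact (hlev p.2).1.ne' h'
  obtain ⟨F, hF⟩ := isCompact_univ.elim_finite_subcover
    (fun U : α => (fun p => j (w p)) ⁻¹' U)
    (fun U => (hαo U U.2).preimage (hj.continuous.comp hw))
    (fun p _ => by
      have := hwX p
      rw [← hα.2] at this
      obtain ⟨U, hU, hp⟩ := this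
      exact mem_iUnion.2 ⟨⟨U, hU⟩, hp⟩)
  let e := F.equivFin
  refine ⟨F.card, fun i => (fun p => j (w p)) ⁻¹' (e.symm i : α),
    fun i => (hαo _ (e.symm i : α).2).preimage (hj.continuous.comp hw), fun p => ?_,
    fun p S hS => ?_, fun i p hp q hq => ?_, fun i p hp q hq h0 h1 => ?_⟩
  · obtain ⟨U, hU, hp⟩ := mem_iUnion₂.1 (hF (mem_univ p))
    exact ⟨e ⟨U, hU⟩, by simpa using hp⟩
  · have hinj : Function.Injective fun i => ((e.symm i : α) : Set T) :=
      Subtype.val_injective.comp (Subtype.val_injective.comp e.symm.injective)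
    have := hm (S.map ⟨_, hinj⟩) (by simp [subset_def]) ⟨j (w p), by
      simpa using hS⟩
    simpa using this
  · have := h₁ _ (e.symm i : α).2 (w p) (w q) hp hq ((hlev p.2).2.trans hat)
    exact lt_of_le_of_lt (le_max_left _ _) this
  · have := h₂ _ (e.symm i : α).2 (w p) (w q) hp hq (by simpa [w, h0] using hbt)
    have h2 : dist (w p).2 (w q).2 < a / 2 := lt_of_le_of_lt (le_max_right _ _) this
    rw [Subtype.dist_eq, Real.dist_eq] at h2
    have := (abs_lt.1 h2).1
    simp [w, h0, h1] at this
    linarith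

/-- A finite partition of unity, at most `m` of whose members are nonzero at any point. -/
structure IsPartition {ι Z : Type*} [Fintype ι] [TopologicalSpace Z] (κ : ι → Z → ℝ) (m : ℕ) :
    Prop where
  continuous : ∀ i, Continuous (κ i)
  nonneg : ∀ i z, 0 ≤ κ i z
  sum_eq_one : ∀ z, ∑ i, κ i z = 1
  card_le : ∀ z (S : Finset ι), (∀ i ∈ S, κ i z ≠ 0) → S.card ≤ m

theorem exists_isPartition {ι Z : Type*} [Fintype ι] [TopologicalSpace Z] [NormalSpace Z]
    [ParacompactSpace Z] {O : ι → Set Z} {m : ℕ} (ho : ∀ i, IsOpen (O i))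
    (hO : ∀ z, ∃ i, z ∈ O i) (hm : ∀ z (S : Finset ι), (∀ i ∈ S, z ∈ O i) → S.card ≤ m) :
    ∃ κ : ι → Z → ℝ, IsPartition κ m ∧ ∀ i z, κ i z ≠ 0 → z ∈ O i := by
  obtain ⟨f, hf⟩ := PartitionOfUnity.exists_isSubordinate isClosed_univ O ho
    fun z _ => mem_iUnion.2 (hO z)
  have hfO : ∀ i z, f i z ≠ 0 → z ∈ O i := fun i z h => hf i (subset_tsupport _ h)
  refine ⟨fun i z => f i z, ⟨fun i => (f i).continuous, fun i z => f.nonneg i z, fun z => ?_,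
    fun z S hS => hm z S fun i hi => hfO i z (hS i hi)⟩, hfO⟩
  rw [← f.sum_eq_one (mem_univ z), finsum_eq_sum_of_fintype]

theorem IsPartition.exists_ne_zero {ι Z : Type*} [Fintype ι] [TopologicalSpace Z]
    {κ : ι → Z → ℝ} {m : ℕ} (h : IsPartition κ m) (z : Z) : ∃ i, κ i z ≠ 0 := by
  by_contra! h0
  simpa [h0] using h.sum_eq_one z

theorem sum_smul_eq_add_sum_erase {ι V : Type*} [Fintype ι] [DecidableEq ι] [AddCommGroup V]
    [Module ℝ V] {c : ι → ℝ} (hc : ∑ i, c i = 1) {S : Finset ι} (hS : ∀ i ∉ S, c i = 0) (i₀ : ι)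
    (v : ι → V) :
    ∑ i, c i • v i = v i₀ + ∑ i : S.erase i₀, c i • (v i - v i₀) := by
  have h1 : ∑ i : S.erase i₀, c i • (v i - v i₀) = ∑ i, c i • (v i - v i₀) := by
    rw [Finset.sum_coe_sort (S.erase i₀) fun i => c i • (v i - v i₀)]
    refine Finset.sum_subset (Finset.subset_univ _) fun i _ hi => ?_
    by_cases h : i = i₀
    · simp [h]
    · simp [hS i fun hiS => hi (Finset.mem_erase.2 ⟨h, hiS⟩)]
  rw [h1]
  simp [smul_sub, Finset.sum_sub_distrib, ← Finset.sum_smul, hc]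

theorem dense_compl_iUnion_range {ι F : Type*} [Countable ι] {D : ι → Type*}
    [∀ i, NormedAddCommGroup (D i)] [∀ i, NormedSpace ℝ (D i)] [∀ i, FiniteDimensional ℝ (D i)]
    [NormedAddCommGroup F] [NormedSpace ℝ F] [FiniteDimensional ℝ F] {g : ∀ i, D i → F}
    (hg : ∀ i, ContDiff ℝ 1 (g i)) {d : ℕ} (hd : ∀ i, Module.finrank ℝ (D i) ≤ d)
    (hdF : d < Module.finrank ℝ F) : Dense (⋃ i, range (g i))ᶜ := by
  refine dense_compl_of_dimH_lt_finrank ?_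
  rw [dimH_iUnion]
  refine lt_of_le_of_lt (iSup_le fun i => (hg i).dimH_range_le.trans ?_) (Nat.cast_lt.2 hdF)
  exact Nat.cast_le.2 (hd i)

/-- A finite subset with a marked point and at most `m + 1` elements. -/
abbrev MarkedSubset (ι : Type*) (m : ℕ) := {p : Finset ι × ι // p.2 ∈ p.1 ∧ p.1.card ≤ m + 1}

theorem MarkedSubset.card_erase_le {ι : Type*} [DecidableEq ι] {m : ℕ} (p : MarkedSubset ι m) :
    Fintype.card (p.1.1.erase p.1.2) ≤ m := by
  have := p.2.2
  rw [Fintype.card_coe, Finset.card_erase_of_mem p.2.1]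
  omega

theorem IsPartition.exists_markedSubset {ι Z : Type*} [Fintype ι] [TopologicalSpace Z]
    {κ : ι → Z → ℝ} {m : ℕ} (h : IsPartition κ (m + 1)) (z : Z) :
    ∃ p : MarkedSubset ι m, ∀ i ∉ p.1.1, κ i z = 0 := by
  classical
  obtain ⟨i, hi⟩ := h.exists_ne_zero z
  exact ⟨⟨(Finset.univ.filter fun i => κ i z ≠ 0, i), by simpa using hi,
    h.card_le z _ (by simp)⟩, by simp⟩

theorem IsPartition.exists_forall_sum_ne {ι Z V : Type*} [Fintype ι] [TopologicalSpace Z]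
    [NormedAddCommGroup V] [NormedSpace ℝ V] [FiniteDimensional ℝ V] {κ : ι → Z → ℝ} {m : ℕ}
    (h : IsPartition κ (m + 1)) (hV : m < Module.finrank ℝ V) (v : ι → V) {δ : ℝ} (hδ : 0 < δ) :
    ∃ e : V, ‖e‖ < δ ∧ ∀ z, ∑ i, κ i z • v i ≠ e := by
  classical
  have hd := dense_compl_iUnion_range (ι := MarkedSubset ι m)
    (D := fun p => p.1.1.erase p.1.2 → ℝ)
    (g := fun p c => v p.1.2 + ∑ i : p.1.1.erase p.1.2, c i • (v i - v p.1.2))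
    (fun p => by fun_prop)
    (fun p => (Module.finrank_fintype_fun_eq_card ℝ).trans_le p.card_erase_le) hV
  obtain ⟨e, he, heδ⟩ := hd.exists_dist_lt 0 hδ
  refine ⟨e, by simpa using heδ, fun z hz => he ?_⟩
  obtain ⟨p, hp⟩ := h.exists_markedSubset z
  refine mem_iUnion.2 ⟨p, fun i => κ i z, ?_⟩
  rw [← hz, sum_smul_eq_add_sum_erase (h.sum_eq_one z) hp p.1.2]

theorem IsPartition.norm_sum_smul_sub_le {ι Z V : Type*} [Fintype ι] [TopologicalSpace Z]
    [NormedAddCommGroup V] [NormedSpace ℝ V] {κ : ι → Z → ℝ} {m : ℕ} (h : IsPartition κ m) {z : Z}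
    {v : ι → V} {a : V} {C : ℝ} (hC : ∀ i, κ i z ≠ 0 → ‖v i - a‖ ≤ C) :
    ‖∑ i, κ i z • v i - a‖ ≤ C := by
  have h1 : ∑ i, κ i z • v i - a = ∑ i, κ i z • (v i - a) := by
    simp [smul_sub, Finset.sum_sub_distrib, ← Finset.sum_smul, h.sum_eq_one z]
  rw [h1]
  calc ‖∑ i, κ i z • (v i - a)‖ ≤ ∑ i, κ i z * C := by
        refine norm_sum_le_of_le _ fun i _ => ?_
        rw [norm_smul, Real.norm_of_nonneg (h.nonneg i z)]
        by_cases hi : κ i z = 0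
        · simp [hi]
        · exact mul_le_mul_of_nonneg_left (hC i hi) (h.nonneg i z)
    _ = C := by rw [← Finset.sum_mul, h.sum_eq_one, one_mul]

theorem HasThinCovers.exists_lift {Y E : Type*} [MetricSpace Y] [CompactSpace Y]
    [NormedAddCommGroup E] [NormedSpace ℝ E] [FiniteDimensional ℝ E] {m : ℕ}
    (h : HasThinCovers Y m) (hE : Module.finrank ℝ E = m) {f : Y → E} (hf : Continuous f) {ω : ℝ}
    (hω : 0 < ω) :
    ∃ (F₁ : Y × unitInterval → E) (F₂ : Y × unitInterval → ℝ), Continuous F₁ ∧ Continuous F₂ ∧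
      (∀ p, ‖F₁ p - f p.1‖ < ω) ∧ (∀ x, F₂ (x, 0) < 0) ∧ (∀ x, 0 < F₂ (x, 1)) ∧
      ∀ p, F₁ p = 0 → F₂ p ≠ 0 := by
  classical
  obtain ⟨δ, hδ, hfδ⟩ := Metric.uniformContinuous_iff.1
    (CompactSpace.uniformContinuous_of_continuous hf) (ω / 2) (half_pos hω)
  obtain ⟨N, O, hOo, hOc, hOm, hOd, hO01⟩ := h δ hδ
  obtain ⟨κ, hκ, hκO⟩ := exists_isPartition hOo hOc hOm
  choose w hw using fun i => show ∃ w : E, ∀ p ∈ O i, ‖w - f p.1‖ ≤ ω / 2 from by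
    rcases (O i).eq_empty_or_nonempty with he | ⟨q, hq⟩
    · exact ⟨0, by simp [he]⟩
    · refine ⟨f q.1, fun p hp => ?_⟩
      rw [← dist_eq_norm]
      exact (hfδ (hOd i q hq p hp)).le
  let c : Fin N → ℝ := fun i => if ∃ p ∈ O i, p.2 = 0 then -1 else 1
  obtain ⟨e, heδ, he⟩ := hκ.exists_forall_sum_ne (V := E × ℝ) (by simp [hE])
    (fun i => (w i, c i)) (lt_min (half_pos hω) one_half_pos)
  have he1 : ‖e.1‖ < ω / 2 := (norm_fst_le e).trans_lt (heδ.trans_le (min_le_left _ _))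
  have he2 : |e.2| < 1 / 2 := (norm_snd_le e).trans_lt (heδ.trans_le (min_le_right _ _))
  have hκc := hκ.continuous
  refine ⟨fun p => ∑ i, κ i p • w i - e.1, fun p => ∑ i, κ i p • c i - e.2, by fun_prop,
    by fun_prop, fun p => ?_, fun x => ?_, fun x => ?_, fun p h1 h2 => he p ?_⟩
  · have := hκ.norm_sum_smul_sub_le (z := p) (v := w) (a := f p.1) fun i hi => hw i p (hκO i p hi)
    calc _ = ‖(∑ i, κ i p • w i - f p.1) - e.1‖ := by rw [sub_right_comm]
      _ ≤ _ := norm_sub_le _ _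
      _ < ω := by linarith
  · have := hκ.norm_sum_smul_sub_le (z := (x, 0)) (v := c) (a := -1) (C := 0) fun i hi => by
      have hc : c i = -1 := if_pos ⟨_, hκO i _ hi, rfl⟩
      simp [hc]
    have h2 := sub_eq_zero.1 (norm_le_zero_iff.1 this)
    change ∑ i, κ i (x, 0) • c i - e.2 < 0
    linarith [(abs_lt.1 he2).1]
  · have := hκ.norm_sum_smul_sub_le (z := (x, 1)) (v := c) (a := 1) (C := 0) fun i hi => by
      have : ¬ ∃ p ∈ O i, p.2 = 0 := fun ⟨p, hp, hp0⟩ => hO01 i p hp _ (hκO i _ hi) hp0 rfl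
      simp only [c, if_neg this, sub_self, norm_zero, le_refl]
    have h2 := sub_eq_zero.1 (norm_le_zero_iff.1 this)
    change 0 < ∑ i, κ i (x, 1) • c i - e.2
    linarith [(abs_lt.1 he2).2]
  · have h1' := sub_eq_zero.1 h1
    have h2' := sub_eq_zero.1 h2
    ext1
    · simpa [Prod.fst_sum] using h1'
    · simpa [Prod.snd_sum] using h2'

theorem HasThinCovers.exists_isPartition {Y : Type*} [MetricSpace Y] [CompactSpace Y] {m : ℕ}
    (h : HasThinCovers Y m) {ε : ℝ} (hε : 0 < ε) :
    ∃ (N : ℕ) (κ : Fin N → Y → ℝ), IsPartition κ (m + 1) ∧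
      ∀ i x y, κ i x ≠ 0 → κ i y ≠ 0 → dist x y < ε := by
  obtain ⟨N, O, hOo, hOc, hOm, hOd, -⟩ := h ε hε
  obtain ⟨κ, hκ, hκO⟩ := _root_.exists_isPartition (Z := Y)
    (O := fun i => (fun x => (x, (0 : unitInterval))) ⁻¹' O i)
    (fun i => (hOo i).preimage (by fun_prop)) (fun x => hOc _) fun x => hOm _
  exact ⟨N, κ, hκ, fun i x y hx hy => hOd i _ (hκO i x hx) _ (hκO i y hy)⟩

theorem exists_forall_add_smul_ne_zero {Z V : Type*} [TopologicalSpace Z] [NormalSpace Z]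
    [NormedAddCommGroup V] [NormedSpace ℝ V] {f g : Z → V} (hf : Continuous f)
    {A : Set Z} (hA : IsClosed A) {ω : ℝ} (hfA : ∀ z ∈ A, ω < ‖f z‖)
    (hfg : ∀ z, ‖g z - f z‖ < ω) (hg0 : ∀ z, g z ≠ 0) :
    ∃ u : Z → ℝ, Continuous u ∧ (∀ z ∈ A, u z = 1) ∧ ∀ z, g z + u z • (f z - g z) ≠ 0 := by
  obtain ⟨u, hu0, hu1, hu⟩ := exists_continuous_zero_one_of_isClosed
    (isClosed_le hf.norm continuous_const : IsClosed {z | ‖f z‖ ≤ ω}) hA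
    (disjoint_left.2 fun z hz hzA => absurd (hfA z hzA) (not_lt.2 hz))
  refine ⟨u, u.continuous, hu1, fun z hz => ?_⟩
  by_cases hzω : ‖f z‖ ≤ ω
  · rw [hu0 hzω] at hz
    exact hg0 z (by simpa using hz)
  · have h1 : f z = (1 - u z) • (f z - g z) := by
      have : f z = (g z + u z • (f z - g z)) + (1 - u z) • (f z - g z) := by module
      rwa [hz, zero_add] at this
    have h2 : ‖f z‖ ≤ ‖g z - f z‖ := by
      rw [norm_sub_rev]
      conv_lhs => rw [h1]
      rw [norm_smul, Real.norm_of_nonneg (by linarith [(hu z).2])]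
      exact mul_le_of_le_one_left (norm_nonneg _) (by linarith [(hu z).1])
    linarith [hfg z]

theorem forall_unitInterval_of_forall_dist_lt {S : unitInterval → Prop} (h0 : S 0) {δ : ℝ}
    (hδ : 0 < δ) (hS : ∀ t t', dist t t' < δ → S t → S t') (t : unitInterval) : S t := by
  have hclopen : IsClopen {t | S t} := by
    refine ⟨⟨Metric.isOpen_iff.2 fun t ht => ⟨δ, hδ, fun t' ht' h => ht (hS t' t ht' h)⟩⟩,
      Metric.isOpen_iff.2 fun t ht => ⟨δ, hδ, fun t' ht' => hS t t' ?_ ht⟩⟩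
    rwa [dist_comm]
  exact (hclopen.eq_univ ⟨0, h0⟩ ▸ mem_univ t : t ∈ {t | S t})

section HopfLift

variable {𝕜 : Type*} [RCLike 𝕜]

open ComplexConjugate

theorem hopf_step_ne_zero {z z' v₁ v₂ : 𝕜} {u u' r r' η : ℝ} (hz : ‖z - z'‖ ≤ η)
    (hu : |u - u'| ≤ η) (hη : 2 * η < r + r') (hv : v₁ ≠ 0 ∨ v₂ ≠ 0)
    (h₁ : ((r + u : ℝ) : 𝕜) * v₁ = conj z * v₂) (h₂ : ((r - u : ℝ) : 𝕜) * v₂ = z * v₁) :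
    ((r' - u' : ℝ) : 𝕜) * v₁ + conj z' * v₂ ≠ 0 ∨ z' * v₁ + ((r' + u' : ℝ) : 𝕜) * v₂ ≠ 0 := by
  by_contra! h
  have hη0 : 0 ≤ η := (norm_nonneg _).trans hz
  have e₁ : ((r + r' : ℝ) : 𝕜) * v₁ = -((u - u' : ℝ) : 𝕜) * v₁ + conj (z - z') * v₂ := by
    have := h.1
    push_cast [map_sub] at this h₁ ⊢
    linear_combination this + h₁
  have e₂ : ((r + r' : ℝ) : 𝕜) * v₂ = ((u - u' : ℝ) : 𝕜) * v₂ + (z - z') * v₁ := by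
    have := h.2
    push_cast at this h₂ ⊢
    linear_combination this + h₂
  have n₁ : (r + r') * ‖v₁‖ ≤ η * ‖v₁‖ + η * ‖v₂‖ := by
    have := norm_add_le (-((u - u' : ℝ) : 𝕜) * v₁) (conj (z - z') * v₂)
    rw [← e₁] at this
    simp only [norm_mul, norm_neg, RCLike.norm_conj, RCLike.norm_ofReal] at this
    rw [abs_of_nonneg (by linarith)] at this
    refine this.trans (add_le_add ?_ ?_) <;> gcongr
  have n₂ : (r + r') * ‖v₂‖ ≤ η * ‖v₂‖ + η * ‖v₁‖ := by
    have := norm_add_le (((u - u' : ℝ) : 𝕜) * v₂) ((z - z') * v₁)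
    rw [← e₂] at this
    simp only [norm_mul, RCLike.norm_ofReal] at this
    rw [abs_of_nonneg (by linarith)] at this
    refine this.trans (add_le_add ?_ ?_) <;> gcongr
  have hpos : 0 < ‖v₁‖ + ‖v₂‖ := by
    rcases hv with hv | hv
    · exact add_pos_of_pos_of_nonneg (norm_pos_iff.2 hv) (norm_nonneg _)
    · exact add_pos_of_nonneg_of_pos (norm_nonneg _) (norm_pos_iff.2 hv)
  nlinarith

/-- A continuous section of the line bundle spanned by the `r`-eigenvectors of the Hermitian
matrices with rows `(-u, conj z)` and `(z, u)`, with normalized direction over `A`. -/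
def HasHopfLift {Y : Type*} [TopologicalSpace Y] (A : Set Y) (f z : Y → 𝕜) (r u : Y → ℝ) : Prop :=
  ∃ v₁ v₂ : Y → 𝕜, Continuous v₁ ∧ Continuous v₂ ∧ (∀ x, v₁ x ≠ 0 ∨ v₂ x ≠ 0) ∧
    (∀ x, ((r x + u x : ℝ) : 𝕜) * v₁ x = conj (z x) * v₂ x) ∧
    (∀ x, ((r x - u x : ℝ) : 𝕜) * v₂ x = z x * v₁ x) ∧
    ∀ x ∈ A, ∃ a b : ℝ, 0 < a ∧ 0 < b ∧ v₁ x = (a : 𝕜) ∧ v₂ x = (b : 𝕜) * f x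

variable {Y : Type*} [TopologicalSpace Y] {A : Set Y} {f z z' : Y → 𝕜} {r r' u u' : Y → ℝ}

theorem HasHopfLift.of_neg (hz : Continuous z) (hr : Continuous r) (hu : Continuous u)
    (hr2 : ∀ x, r x ^ 2 = ‖z x‖ ^ 2 + u x ^ 2) (hr0 : ∀ x, 0 < r x) (hu0 : ∀ x, u x < 0)
    (hA : ∀ x ∈ A, z x = f x) : HasHopfLift A f z r u := by
  refine ⟨fun x => ((r x - u x : ℝ) : 𝕜), z, RCLike.continuous_ofReal.comp (hr.sub hu), hz,
    fun x => Or.inl ?_, fun x => ?_, fun x => mul_comm _ _,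
    fun x hx => ?_⟩
  · exact RCLike.ofReal_ne_zero.2 (by linarith [hr0 x, hu0 x])
  · rw [RCLike.conj_mul, ← RCLike.ofReal_mul, ← RCLike.ofReal_pow]
    congr 1
    linarith [hr2 x]
  · exact ⟨r x - u x, 1, by linarith [hr0 x, hu0 x], one_pos, rfl, by simp [hA x hx]⟩

theorem HasHopfLift.step (h : HasHopfLift A f z r u) (hz' : Continuous z') (hr' : Continuous r')
    (hu' : Continuous u') (hr2' : ∀ x, r' x ^ 2 = ‖z' x‖ ^ 2 + u' x ^ 2) (hr0' : ∀ x, 0 < r' x)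
    (hA : ∀ x ∈ A, z' x = f x) (hf : ∀ x ∈ A, f x ≠ 0) {η : ℝ} (hz : ∀ x, ‖z x - z' x‖ ≤ η)
    (hu : ∀ x, |u x - u' x| ≤ η) (hη : ∀ x, 2 * η < r x + r' x) : HasHopfLift A f z' r' u' := by
  obtain ⟨v₁, v₂, hv₁, hv₂, hv, h₁, h₂, hvA⟩ := h
  have key : ∀ x, ((r' x : ℝ) : 𝕜) ^ 2 = conj (z' x) * z' x + ((u' x : ℝ) : 𝕜) ^ 2 := fun x => by
    rw [RCLike.conj_mul]
    exact_mod_cast congrArg ((↑) : ℝ → 𝕜) (hr2' x)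
  have hu_le : ∀ x, |u' x| ≤ r' x := fun x =>
    abs_le_of_sq_le_sq (by nlinarith [hr2' x, sq_nonneg ‖z' x‖]) (hr0' x).le
  refine ⟨fun x => ((r' x - u' x : ℝ) : 𝕜) * v₁ x + conj (z' x) * v₂ x,
    fun x => z' x * v₁ x + ((r' x + u' x : ℝ) : 𝕜) * v₂ x, ?_, ?_,
    fun x => hopf_step_ne_zero (hz x) (hu x) (hη x) (hv x) (h₁ x) (h₂ x), fun x => ?_, fun x => ?_,
    fun x hx => ?_⟩
  · exact ((RCLike.continuous_ofReal.comp (hr'.sub hu')).mul hv₁).add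
      ((RCLike.continuous_conj.comp hz').mul hv₂)
  · exact (hz'.mul hv₁).add ((RCLike.continuous_ofReal.comp (hr'.add hu')).mul hv₂)
  · push_cast
    linear_combination v₁ x * key x
  · push_cast
    linear_combination v₂ x * key x
  · obtain ⟨a, b, ha, hb, hva, hvb⟩ := hvA x hx
    have hu'x := abs_le.1 (hu_le x)
    have hfx : 0 < ‖f x‖ := norm_pos_iff.2 (hf x hx)
    refine ⟨(r' x - u' x) * a + b * ‖f x‖ ^ 2, a + (r' x + u' x) * b, ?_, ?_, ?_, ?_⟩
    · exact add_pos_of_nonneg_of_pos (mul_nonneg (by linarith) ha.le) (by positivity)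
    · exact add_pos_of_pos_of_nonneg ha (mul_nonneg (by linarith) hb.le)
    · have := RCLike.conj_mul (f x)
      beta_reduce
      rw [hA x hx, hva, hvb]
      push_cast
      linear_combination (b : 𝕜) * this
    · beta_reduce
      rw [hA x hx, hva, hvb]
      push_cast
      ring

end HopfLift

theorem exists_pos_forall_lt_norm {Z V : Type*} [TopologicalSpace Z] [CompactSpace Z]
    [NormedAddCommGroup V] {f : Z → V} (hf : Continuous f) {A : Set Z} (hA : IsClosed A)
    (h : ∀ z ∈ A, f z ≠ 0) : ∃ ω > 0, ∀ z ∈ A, ω < ‖f z‖ := by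
  obtain ⟨ω, hω, hωA⟩ := hA.isCompact.exists_forall_le' hf.norm.continuousOn
    fun z hz => norm_pos_iff.2 (h z hz)
  exact ⟨ω / 2, half_pos hω, fun z hz => by linarith [hωA z hz]⟩

theorem HasThinCovers.exists_pos_smul_eq_of_rclike {Y 𝕜 : Type*} [MetricSpace Y] [CompactSpace Y]
    [RCLike 𝕜] {m : ℕ} (h : HasThinCovers Y m) (hm : Module.finrank ℝ 𝕜 = m) {f : Y → 𝕜}
    (hf : Continuous f) {A : Set Y} (hA : IsClosed A) (hfA : ∀ x ∈ A, f x ≠ 0) :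
    ∃ g : Y → 𝕜, Continuous g ∧ (∀ x, g x ≠ 0) ∧ ∀ x ∈ A, ∃ c : ℝ, 0 < c ∧ g x = c • f x := by
  obtain ⟨ω, hω, hωA⟩ := exists_pos_forall_lt_norm hf hA hfA
  obtain ⟨F₁, F₂, hF₁, hF₂, hFf, hF0, hF1, hF⟩ := h.exists_lift hm hf hω
  obtain ⟨w, hw, hwA, hwF⟩ := exists_forall_add_smul_ne_zero
    (f := fun p : Y × unitInterval => (f p.1, F₂ p)) (g := fun p => (F₁ p, F₂ p)) (by fun_prop)
    (hA.preimage continuous_fst) (ω := ω)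
    (fun p hp => (hωA p.1 hp).trans_le (norm_fst_le (f p.1, F₂ p)))
    (fun p => by simpa [Prod.norm_def, hω] using hFf p)
    (fun p hp => hF p (congrArg Prod.fst hp) (congrArg Prod.snd hp))
  let z : Y × unitInterval → 𝕜 := fun p => F₁ p + w p • (f p.1 - F₁ p)
  have hz : Continuous z := by fun_prop
  have hzA : ∀ p : Y × unitInterval, p.1 ∈ A → z p = f p.1 := fun p hp => by simp [z, hwA p hp]
  have hzF : ∀ p, z p = 0 → F₂ p ≠ 0 := fun p h1 h2 => hwF p (Prod.ext h1 (by simp [h2]))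
  let r : Y × unitInterval → ℝ := fun p => √(‖z p‖ ^ 2 + F₂ p ^ 2)
  have hr : Continuous r := by fun_prop
  have hrpos : ∀ p, 0 < ‖z p‖ ^ 2 + F₂ p ^ 2 := fun p => by
    by_cases hp : z p = 0
    · have := hzF p hp
      positivity
    · have := norm_pos_iff.2 hp
      positivity
  have hr0 : ∀ p, 0 < r p := fun p => Real.sqrt_pos.2 (hrpos p)
  have hr2 : ∀ p, r p ^ 2 = ‖z p‖ ^ 2 + F₂ p ^ 2 := fun p => Real.sq_sqrt (hrpos p).le
  obtain ⟨η, hη, hηr⟩ := exists_pos_forall_lt_norm hr isClosed_univ fun p _ => (hr0 p).ne'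
  obtain ⟨δ, hδ, hδF⟩ := Metric.uniformContinuous_iff.1
    (CompactSpace.uniformContinuous_of_continuous (hz.prodMk hF₂)) η hη
  have key : HasHopfLift A f (fun x => z (x, 1)) (fun x => r (x, 1)) fun x => F₂ (x, 1) := by
    refine forall_unitInterval_of_forall_dist_lt
      (S := fun t => HasHopfLift A f (fun x => z (x, t)) (fun x => r (x, t)) fun x => F₂ (x, t))
      (.of_neg (by fun_prop) (by fun_prop) (by fun_prop) (fun x => hr2 _) (fun x => hr0 _) hF0
        fun x hx => hzA _ hx) hδ (fun t t' htt' hS => ?_) 1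
    have hd : ∀ x, dist (z (x, t), F₂ (x, t)) (z (x, t'), F₂ (x, t')) < η := fun x =>
      hδF (by simpa [Prod.dist_eq, hδ] using htt')
    refine hS.step (η := η) (by fun_prop) (by fun_prop) (by fun_prop) (fun x => hr2 _)
      (fun x => hr0 _) (fun x hx => hzA _ hx) hfA (fun x => ?_) (fun x => ?_) fun x => ?_
    · rw [← dist_eq_norm]
      exact (le_max_left _ _).trans (hd x).le
    · rw [← Real.dist_eq]
      exact (le_max_right _ _).trans (hd x).le
    · have h1 := hηr (x, t) trivial
      have h2 := hηr (x, t') trivial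
      rw [Real.norm_of_nonneg (hr0 _).le] at h1 h2
      linarith
  obtain ⟨v₁, v₂, -, hv₂, hv, h₁, -, hvA⟩ := key
  refine ⟨v₂, hv₂, fun x hx => ?_, fun x hx => ?_⟩
  · have h3 := h₁ x
    rw [hx, mul_zero] at h3
    rcases mul_eq_zero.1 h3 with h4 | h4
    · exact absurd (RCLike.ofReal_eq_zero.1 h4) (add_pos (hr0 _) (hF1 x)).ne'
    · exact (hv x).elim (fun h => h h4) fun h => h hx
  · obtain ⟨a, b, -, hb, -, h3⟩ := hvA x hx
    exact ⟨b, hb, by rw [h3, RCLike.real_smul_eq_coe_mul]⟩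

theorem IsPartition.exists_forall_sum_smul_ne {ι Z E : Type*} [Fintype ι] [TopologicalSpace Z]
    [NormedAddCommGroup E] [NormedSpace ℝ E] [FiniteDimensional ℝ E] {κ : ι → Z → ℝ} {m : ℕ}
    (h : IsPartition κ (m + 1)) (hE : m + 2 < 2 * Module.finrank ℝ E) {γ : ι → ℝ → E}
    (hγ : ∀ i, ContDiff ℝ 1 (γ i)) {δ : ℝ} (hδ : 0 < δ) :
    ∃ p q : E, ‖p‖ < δ ∧ ‖q‖ < δ ∧
      ∀ z s t, ∑ i, κ i z • γ i s = p → ∑ i, κ i z • γ i t ≠ q := by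
  classical
  let G : (p : MarkedSubset ι m) → (p.1.1.erase p.1.2 → ℝ) → ℝ → E := fun p c s =>
    γ p.1.2 s + ∑ i : p.1.1.erase p.1.2, c i • (γ i s - γ p.1.2 s)
  have hd := dense_compl_iUnion_range (ι := MarkedSubset ι m) (F := E × E) (d := m + 2)
    (D := fun p => (p.1.1.erase p.1.2 → ℝ) × ℝ × ℝ)
    (g := fun p c => (G p c.1 c.2.1, G p c.1 c.2.2))
    (fun p => by
      refine ContDiff.prodMk ?_ ?_
      · exact ((hγ _).comp (by fun_prop)).add (ContDiff.sum fun i _ => ContDiff.smul (by fun_prop)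
          (((hγ _).comp (by fun_prop)).sub ((hγ _).comp (by fun_prop))))
      · exact ((hγ _).comp (by fun_prop)).add (ContDiff.sum fun i _ => ContDiff.smul (by fun_prop)
          (((hγ _).comp (by fun_prop)).sub ((hγ _).comp (by fun_prop)))))
    (fun p => by
      have := p.card_erase_le
      rw [Module.finrank_prod, Module.finrank_prod, Module.finrank_fintype_fun_eq_card,
        Module.finrank_self]
      omega)
    (by rw [Module.finrank_prod]; omega)
  obtain ⟨e, he, heδ⟩ := hd.exists_dist_lt 0 hδ
  rw [dist_zero_left] at heδ
  refine ⟨e.1, e.2, (norm_fst_le e).trans_lt heδ, (norm_snd_le e).trans_lt heδ,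
    fun z s t h1 h2 => he ?_⟩
  obtain ⟨p, hp⟩ := h.exists_markedSubset z
  refine mem_iUnion.2 ⟨p, (fun i => κ i z, s, t), ?_⟩
  ext1
  · rw [← h1, sum_smul_eq_add_sum_erase (h.sum_eq_one z) hp p.1.2]
  · rw [← h2, sum_smul_eq_add_sum_erase (h.sum_eq_one z) hp p.1.2]

theorem HasThinCovers.exists_ne_zero_of_three_le {Y E : Type*} [MetricSpace Y] [CompactSpace Y]
    [NormedAddCommGroup E] [NormedSpace ℝ E] [FiniteDimensional ℝ E] {m : ℕ}
    (h : HasThinCovers Y m) (hE : Module.finrank ℝ E = m) (hm : 3 ≤ m) {f : Y → E}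
    (hf : Continuous f) {A : Set Y} (hA : IsClosed A) (hfA : ∀ x ∈ A, f x ≠ 0) :
    ∃ g : Y → E, Continuous g ∧ (∀ x, g x ≠ 0) ∧ ∀ x ∈ A, g x = f x := by
  obtain ⟨ω, hω, hωA⟩ := exists_pos_forall_lt_norm hf hA hfA
  obtain ⟨F₁, F₂, hF₁, hF₂, hFf, hF0, hF1, hF⟩ := h.exists_lift hE hf (half_pos hω)
  obtain ⟨ε, hε, hεω, hεF⟩ : ∃ ε > 0, ε ≤ ω / 2 ∧ ∀ p, ‖F₁ p‖ < ε → ε < |F₂ p| := by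
    obtain ⟨c, hc, hcF⟩ := exists_pos_forall_lt_norm (f := fun p => (F₁ p, F₂ p)) (by fun_prop)
      isClosed_univ fun p _ hp => hF p (congrArg Prod.fst hp) (congrArg Prod.snd hp)
    refine ⟨min (ω / 2) c, lt_min (half_pos hω) hc, min_le_left _ _, fun p hp => ?_⟩
    rcases lt_max_iff.1 (hcF p trivial) with h1 | h1
    · exact absurd (hp.trans_le (min_le_right _ _)) h1.not_gt
    · exact (min_le_right _ _).trans_lt h1
  obtain ⟨δ, hδ, hδF⟩ := Metric.uniformContinuous_iff.1
    (CompactSpace.uniformContinuous_of_continuous hF₁) (ε / 4) (by linarith)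
  obtain ⟨N, κ, hκ, hκd⟩ := h.exists_isPartition hδ
  choose γ hγ hγF using fun i => show ∃ γ : ℝ → E, ContDiff ℝ 1 γ ∧
      ∀ x, κ i x ≠ 0 → ∀ t : unitInterval, ‖γ t - F₁ (x, t)‖ ≤ ε / 2 from by
    by_cases hi : ∃ x, κ i x ≠ 0
    · obtain ⟨y, hy⟩ := hi
      obtain ⟨γ, hγ, hγy, -⟩ := Continuous.exists_contDiff_approx
        (f := fun t : ℝ => F₁ (y, projIcc 0 1 zero_le_one t)) (ε := fun _ => ε / 4) 1
        (hF₁.comp (by fun_prop)) continuous_const fun _ => by linarith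
      refine ⟨γ, by exact_mod_cast hγ, fun x hx t => ?_⟩
      have h1 := hγy t
      have h2 := hδF (a := (y, t)) (b := (x, t))
        (by simpa [Prod.dist_eq, hδ] using hκd i y x hy hx)
      rw [projIcc_val] at h1
      have := dist_triangle (γ t) (F₁ (y, t)) (F₁ (x, t))
      rw [← dist_eq_norm]
      linarith
    · push Not at hi
      exact ⟨0, contDiff_const, fun x hx => absurd (hi x) hx⟩
  obtain ⟨p, q, hp, hq, hpq⟩ := hκ.exists_forall_sum_smul_ne (by omega) hγ (half_pos hε)
  let G : Y × unitInterval → E := fun x => ∑ i, κ i x.1 • γ i x.2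
  have hκc := hκ.continuous
  have hγc := fun i => (hγ i).continuous
  have hG : Continuous G := by fun_prop
  have hGF : ∀ x, ‖G x - F₁ x‖ ≤ ε / 2 := fun x =>
    hκ.norm_sum_smul_sub_le fun i hi => hγF i x.1 hi x.2
  obtain ⟨τ, hτQ, hτP, hτ⟩ := exists_continuous_zero_one_of_isClosed
    (s := Prod.fst '' {x : Y × unitInterval | G x = q ∧ 0 ≤ F₂ x})
    (t := Prod.fst '' {x : Y × unitInterval | G x = p ∧ F₂ x ≤ 0})
    (((isClosed_eq hG continuous_const).inter
      (isClosed_le continuous_const hF₂)).isCompact.image continuous_fst).isClosed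
    (((isClosed_eq hG continuous_const).inter
      (isClosed_le hF₂ continuous_const)).isCompact.image continuous_fst).isClosed
    (disjoint_left.2 fun x ⟨a, ha, hax⟩ ⟨b, hb, hbx⟩ => hpq x b.2 a.2
      (by simpa [G, hbx] using hb.1) (by simpa [G, hax] using ha.1))
  let σ : ℝ → ℝ := fun r => max 0 (min 1 ((r + ε) / (2 * ε)))
  have hσ : Continuous σ := by fun_prop
  have hσI : ∀ r, σ r ∈ Icc (0 : ℝ) 1 := fun r =>
    ⟨le_max_left _ _, max_le zero_le_one (min_le_left _ _)⟩
  let w : Y → Y × unitInterval := fun x => (x, ⟨τ x, hτ x⟩)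
  have hw : Continuous w := by fun_prop
  let l : Y → E := fun x => p + σ (F₂ (w x)) • (q - p)
  have hl : Continuous l := by fun_prop
  have hlε : ∀ x, ‖l x‖ < ε / 2 := fun x => by
    have := (convex_ball (0 : E) (ε / 2)).add_smul_sub_mem (mem_ball_zero_iff.2 hp)
      (mem_ball_zero_iff.2 hq) (hσI (F₂ (w x)))
    exact mem_ball_zero_iff.1 this
  have hgf : ∀ x, ‖G (w x) - l x - f x‖ < ω := fun x => by
    have h1 : G (w x) - l x - f x = (G (w x) - F₁ (w x)) - l x + (F₁ (w x) - f x) := by abel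
    have h2 := norm_add_le (G (w x) - F₁ (w x) - l x) (F₁ (w x) - f x)
    have h3 := norm_sub_le (G (w x) - F₁ (w x)) (l x)
    rw [h1]
    linarith [hGF (w x), hlε x, hFf (w x)]
  have hg0 : ∀ x, G (w x) - l x ≠ 0 := fun x hx => by
    have hxl := sub_eq_zero.1 hx
    have hlt : ‖F₁ (w x)‖ < ε := by
      have := norm_sub_le (G (w x)) (G (w x) - F₁ (w x))
      rw [sub_sub_cancel] at this
      linarith [hGF (w x), hxl ▸ hlε x]
    rcases lt_abs.1 (hεF _ hlt) with h1 | h1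
    · have hσ1 : σ (F₂ (w x)) = 1 := by
        have : 1 ≤ (F₂ (w x) + ε) / (2 * ε) := by
          rw [one_le_div (by positivity)]
          linarith
        simp [σ, this]
      have hx0 : τ x = 0 := hτQ ⟨w x, ⟨by rw [hxl]; simp [l, hσ1], (hε.trans h1).le⟩, rfl⟩
      have hwx : w x = (x, 0) := Prod.ext rfl (Subtype.ext hx0)
      linarith [hwx ▸ hF0 x]
    · have hσ0 : σ (F₂ (w x)) = 0 := by
        have : (F₂ (w x) + ε) / (2 * ε) ≤ 0 := div_nonpos_of_nonpos_of_nonneg (by linarith)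
          (by positivity)
        simp [σ, this]
      have hx1 : τ x = 1 := hτP ⟨w x, ⟨by rw [hxl]; simp [l, hσ0], by linarith⟩, rfl⟩
      have hwx : w x = (x, 1) := Prod.ext rfl (Subtype.ext hx1)
      linarith [hwx ▸ hF1 x]
  obtain ⟨u, hu, huA, hug⟩ := exists_forall_add_smul_ne_zero hf hA hωA hgf hg0
  exact ⟨_, by fun_prop, hug, fun x hx => by simp [huA x hx]⟩

theorem HasThinCovers.exists_pos_smul_eq {Y E : Type*} [MetricSpace Y] [CompactSpace Y]
    [NormedAddCommGroup E] [NormedSpace ℝ E] [FiniteDimensional ℝ E] {m : ℕ}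
    (h : HasThinCovers Y m) (hm : 0 < m) (hE : Module.finrank ℝ E = m) {f : Y → E}
    (hf : Continuous f) {A : Set Y} (hA : IsClosed A) (hfA : ∀ x ∈ A, f x ≠ 0) :
    ∃ g : Y → E, Continuous g ∧ (∀ x, g x ≠ 0) ∧ ∀ x ∈ A, ∃ c : ℝ, 0 < c ∧ g x = c • f x := by
  rcases le_or_gt 3 m with hm3 | hm3
  · obtain ⟨g, hg, hg0, hgA⟩ := h.exists_ne_zero_of_three_le hE hm3 hf hA hfA
    exact ⟨g, hg, hg0, fun x hx => ⟨1, one_pos, by rw [hgA x hx, one_smul]⟩⟩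
  · have transfer : ∀ {𝕜 : Type} [RCLike 𝕜], Module.finrank ℝ 𝕜 = m → ∃ g : Y → E, Continuous g ∧
        (∀ x, g x ≠ 0) ∧ ∀ x ∈ A, ∃ c : ℝ, 0 < c ∧ g x = c • f x := by
      intro 𝕜 _ h𝕜
      let e : E ≃L[ℝ] 𝕜 := ContinuousLinearEquiv.ofFinrankEq (hE.trans h𝕜.symm)
      obtain ⟨g, hg, hg0, hgA⟩ := h.exists_pos_smul_eq_of_rclike h𝕜 (e.continuous.comp hf) hA
        fun x hx => by simpa using hfA x hx
      refine ⟨fun x => e.symm (g x), e.symm.continuous.comp hg, fun x => by simpa using hg0 x,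
        fun x hx => ?_⟩
      obtain ⟨c, hc, hgx⟩ := hgA x hx
      exact ⟨c, hc, by simp [hgx]⟩
    obtain rfl | rfl : m = 1 ∨ m = 2 := by omega
    · exact transfer (𝕜 := ℝ) (Module.finrank_self ℝ)
    · exact transfer (𝕜 := ℂ) Complex.finrank_real_complex

theorem IsPartition.of_ne_zero_imp {ι Z : Type*} [Fintype ι] [TopologicalSpace Z]
    {κ κ' : ι → Z → ℝ} {m : ℕ} (h : IsPartition κ m) (hc : ∀ i, Continuous (κ' i))
    (h0 : ∀ i z, 0 ≤ κ' i z) (h1 : ∀ z, ∑ i, κ' i z = 1)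
    (hκ : ∀ i z, κ' i z ≠ 0 → κ i z ≠ 0) : IsPartition κ' m :=
  ⟨hc, h0, h1, fun z S hS => h.card_le z S fun i hi => hκ i z (hS i hi)⟩

theorem HasThinCovers.exists_forall_exists_eq_zero {ι Y : Type*} [Fintype ι] [MetricSpace Y]
    [CompactSpace Y] {m : ℕ} (h : HasThinCovers Y m) (hm : 0 < m) {κ : ι → Y → ℝ}
    (hκ : IsPartition κ (m + 1)) {S : Finset ι} (hS : S.card = m + 1) :
    ∃ κ' : ι → Y → ℝ, IsPartition κ' (m + 1) ∧ (∀ i x, κ' i x ≠ 0 → κ i x ≠ 0) ∧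
      ∀ x, ∃ i ∈ S, κ' i x = 0 := by
  classical
  have hSne : S.Nonempty := Finset.card_pos.1 (by omega)
  obtain ⟨v, hv⟩ := hSne
  have hκc := hκ.continuous
  let B : Set Y := {x | ∀ i ∉ S, κ i x = 0}
  let C : Set Y := {x | ∃ i ∈ S, κ i x = 0}
  have hB : IsClosed B := by
    simp only [B, ofPred_forall]
    exact isClosed_iInter fun i => isClosed_iInter fun _ => isClosed_eq (hκc i) continuous_const
  have hC : IsClosed C := by
    have : C = ⋃ i ∈ S, {x | κ i x = 0} := by
      ext x
      simp [C]
    rw [this]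
    exact isClosed_biUnion_finset fun i _ => isClosed_eq (hκc i) continuous_const
  have hBC : ∀ x ∉ C, x ∈ B := fun x hx i hi => by
    by_contra h0
    have := hκ.card_le x (insert i S) (Finset.forall_mem_insert _ _ _ |>.2
      ⟨h0, fun j hj hj0 => hx ⟨j, hj, hj0⟩⟩)
    rw [Finset.card_insert_of_notMem hi] at this
    omega
  have hsumB : ∀ x ∈ B, ∑ i ∈ S, κ i x = 1 := fun x hx => by
    rw [← hκ.sum_eq_one x]
    exact Finset.sum_subset (Finset.subset_univ _) fun i _ hi => hx i hi
  obtain ⟨g, hg, hg0, hgA⟩ := h.exists_pos_smul_eq hm (E := S.erase v → ℝ)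
    (by rw [Module.finrank_fintype_fun_eq_card, Fintype.card_coe, Finset.card_erase_of_mem hv]
        omega)
    (f := fun x i => κ i x - κ v x) (by fun_prop) (hB.inter hC) (fun x ⟨hxB, i, hi, hi0⟩ h0 => by
      have hall : ∀ j ∈ S, κ j x = κ v x := fun j hj => by
        by_cases hjv : j = v
        · rw [hjv]
        · exact sub_eq_zero.1 (congrFun h0 ⟨j, Finset.mem_erase.2 ⟨hjv, hj⟩⟩)
      have := hsumB x hxB
      rw [Finset.sum_eq_zero fun j hj => by rw [hall j hj, ← hall i hi, hi0]] at this
      exact zero_ne_one this)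
  let G : ι → Y → ℝ := fun i x => if hi : i ∈ S.erase v then g x ⟨i, hi⟩ else 0
  have hG : ∀ i, Continuous (G i) := fun i => by
    by_cases hi : i ∈ S.erase v
    · simp only [G, dif_pos hi]
      fun_prop
    · simp only [G, dif_neg hi]
      fun_prop
  let μ : Y → ℝ := fun x => S.inf' ⟨v, hv⟩ fun i => G i x
  have hμ : Continuous μ := Continuous.finset_inf'_apply _ fun i _ => hG i
  have hμle : ∀ i ∈ S, ∀ x, μ x ≤ G i x := fun i hi x =>
    Finset.inf'_le (fun i => G i x) hi
  let D : Y → ℝ := fun x => ∑ i ∈ S, (G i x - μ x)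
  have hD : Continuous D := by fun_prop
  have hD0 : ∀ x, 0 < D x := fun x => by
    refine (Finset.sum_nonneg fun i hi => sub_nonneg.2 (hμle i hi x)).lt_of_ne fun h0 => hg0 x ?_
    have hall := (Finset.sum_eq_zero_iff_of_nonneg fun i hi => sub_nonneg.2 (hμle i hi x)).1 h0.symm
    ext ⟨i, hi⟩
    have h1 := hall i (Finset.mem_of_mem_erase hi)
    have h2 := hall v hv
    simp only [G, dif_pos hi] at h1
    simp only [G, Finset.notMem_erase, dite_false] at h2
    simp only [Pi.zero_apply]
    linarith
  let k : ι → Y → ℝ := fun i x => if i ∈ S then (G i x - μ x) / D x else 0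
  have hk : ∀ i, Continuous (k i) := fun i => by
    by_cases hi : i ∈ S
    · simp only [k, if_pos hi]
      exact ((hG i).sub hμ).div hD fun x => (hD0 x).ne'
    · simp only [k, if_neg hi]
      fun_prop
  have hkκ : ∀ i, ∀ x ∈ B, x ∈ C → k i x = κ i x := fun i x hxB hxC => by
    by_cases hi : i ∈ S
    · obtain ⟨c, hc, hgx⟩ := hgA x ⟨hxB, hxC⟩
      have hGx : ∀ j ∈ S, G j x = c * (κ j x - κ v x) := fun j hj => by
        by_cases hjv : j = v
        · simp [G, hjv]
        · simp [G, hjv, hj, hgx]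
      have hμx : μ x = -(c * κ v x) := by
        obtain ⟨j, hj, hj0⟩ := hxC
        refine le_antisymm ((hμle j hj x).trans_eq (by rw [hGx j hj, hj0]; ring)) ?_
        refine Finset.le_inf' _ _ fun i hi => ?_
        rw [hGx i hi]
        nlinarith [hκ.nonneg i x]
      have hsub : ∀ j ∈ S, G j x - μ x = c * κ j x := fun j hj => by
        rw [hGx j hj, hμx]
        ring
      have hDx : D x = c := by
        simp only [D]
        rw [Finset.sum_congr rfl hsub, ← Finset.mul_sum, hsumB x hxB, mul_one]
      simp only [k, if_pos hi, hsub i hi, hDx]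
      field_simp
    · simp only [k, if_neg hi, hxB i hi]
  let κ' : ι → Y → ℝ := fun i x => if x ∈ C then κ i x else k i x
  have hκ'C : ∀ i, ∀ x ∈ C, κ' i x = κ i x := fun i x hx => if_pos hx
  have hκ'B : ∀ i, ∀ x ∈ B, κ' i x = k i x := fun i x hx => by
    by_cases hxC : x ∈ C
    · rw [hκ'C i x hxC, hkκ i x hx hxC]
    · exact if_neg hxC
  have hk0 : ∀ i x, 0 ≤ k i x := fun i x => by
    by_cases hi : i ∈ S
    · simp only [k, if_pos hi]
      exact div_nonneg (sub_nonneg.2 (hμle i hi x)) (hD0 x).le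
    · simp only [k, if_neg hi, le_refl]
  have hsupp : ∀ i x, κ' i x ≠ 0 → κ i x ≠ 0 := fun i x hx => by
    by_cases hxC : x ∈ C
    · rwa [hκ'C i x hxC] at hx
    · rw [hκ'B i x (hBC x hxC)] at hx
      have hi : i ∈ S := by
        by_contra hi
        exact hx (if_neg hi)
      exact fun h0 => hxC ⟨i, hi, h0⟩
  refine ⟨κ', hκ.of_ne_zero_imp (fun i => ?_) (fun i x => ?_) (fun x => ?_) hsupp, hsupp,
    fun x => ?_⟩
  · have := ContinuousOn.union_of_isClosed ((hκc i).continuousOn.congr fun x hx => hκ'C i x hx)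
      ((hk i).continuousOn.congr fun x hx => hκ'B i x hx) hC hB
    have hCB : C ∪ B = univ := eq_univ_of_forall fun x => (em (x ∈ C)).imp id (hBC x)
    rwa [hCB, continuousOn_univ] at this
  · by_cases hxC : x ∈ C
    · rw [hκ'C i x hxC]
      exact hκ.nonneg i x
    · rw [hκ'B i x (hBC x hxC)]
      exact hk0 i x
  · by_cases hxC : x ∈ C
    · simp only [hκ'C _ x hxC, hκ.sum_eq_one]
    · simp only [hκ'B _ x (hBC x hxC), k]
      rw [Finset.sum_ite_mem, Finset.univ_inter, ← Finset.sum_div]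
      exact div_self (hD0 x).ne'
  · by_cases hxC : x ∈ C
    · obtain ⟨i, hi, h0⟩ := hxC
      exact ⟨i, hi, by rw [hκ'C i x ⟨i, hi, h0⟩, h0]⟩
    · obtain ⟨i, hi, h0⟩ := S.exists_mem_eq_inf' ⟨v, hv⟩ fun i => G i x
      refine ⟨i, hi, ?_⟩
      rw [hκ'B i x (hBC x hxC)]
      simp only [k, if_pos hi, μ, h0, sub_self, zero_div]

theorem HasThinCovers.exists_isPartition_of_ne_zero_imp {ι Y : Type*} [Fintype ι] [MetricSpace Y]
    [CompactSpace Y] {m : ℕ} (h : HasThinCovers Y m) (hm : 0 < m) {κ : ι → Y → ℝ}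
    (hκ : IsPartition κ (m + 1)) :
    ∃ κ' : ι → Y → ℝ, IsPartition κ' m ∧ ∀ i x, κ' i x ≠ 0 → κ i x ≠ 0 := by
  classical
  have key : ∀ 𝒮 : Finset (Finset ι), (∀ S ∈ 𝒮, S.card = m + 1) → ∃ κ' : ι → Y → ℝ,
      IsPartition κ' (m + 1) ∧ (∀ i x, κ' i x ≠ 0 → κ i x ≠ 0) ∧
        ∀ S ∈ 𝒮, ∀ x, ∃ i ∈ S, κ' i x = 0 := by
    intro 𝒮
    induction 𝒮 using Finset.induction_on with
    | empty => exact fun _ => ⟨κ, hκ, fun _ _ => id, by simp⟩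
    | insert S 𝒮 _ ih =>
      intro hcard
      obtain ⟨κ₁, h₁, hs₁, hz₁⟩ := ih fun S hS => hcard S (Finset.mem_insert_of_mem hS)
      obtain ⟨κ₂, h₂, hs₂, hz₂⟩ := h.exists_forall_exists_eq_zero hm h₁
        (hcard S (Finset.mem_insert_self _ _))
      refine ⟨κ₂, h₂, fun i x hx => hs₁ i x (hs₂ i x hx), Finset.forall_mem_insert _ _ _ |>.2
        ⟨hz₂, fun S' hS' x => ?_⟩⟩
      obtain ⟨i, hi, h0⟩ := hz₁ S' hS' x
      exact ⟨i, hi, by_contra fun h => hs₂ i x h h0⟩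
  obtain ⟨κ', h', hs, hz⟩ := key (Finset.univ.powersetCard (m + 1)) fun S hS =>
    (Finset.mem_powersetCard.1 hS).2
  refine ⟨κ', ⟨h'.continuous, h'.nonneg, h'.sum_eq_one, fun x S hS => ?_⟩, hs⟩
  refine Nat.lt_succ_iff.1 ((h'.card_le x S hS).lt_of_ne fun hcard => ?_)
  obtain ⟨i, hi, h0⟩ := hz S (Finset.mem_powersetCard.2 ⟨Finset.subset_univ _, hcard⟩) x
  exact hS i hi h0

theorem HasThinCovers.dimLE {Y : Type*} [MetricSpace Y] [CompactSpace Y] {n : ℕ}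
    (h : HasThinCovers Y (n + 1)) : DimLE Y (n : ℤ) := by
  rcases isEmpty_or_nonempty Y with hY | ⟨⟨y⟩⟩
  · exact Or.inl ⟨hY, by omega⟩
  refine Or.inr ⟨n, rfl, fun α _ hα hcov => ?_⟩
  obtain ⟨δ, hδ, hδα⟩ := lebesgue_number_lemma_of_metric_sUnion isCompact_univ hα hcov.ge
  obtain ⟨N, κ₀, hκ₀, hd⟩ := h.exists_isPartition hδ
  obtain ⟨κ, hκ, hs⟩ := h.exists_isPartition_of_ne_zero_imp n.succ_pos hκ₀
  refine ⟨range fun i => {x | κ i x ≠ 0}, finite_range _, ?_, ?_, ?_, MultLE.range hκ.card_le⟩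
  · rintro _ ⟨i, rfl⟩
    exact isOpen_ne_fun (hκ.continuous i) continuous_const
  · refine eq_univ_of_forall fun x => ?_
    obtain ⟨i, hi⟩ := hκ.exists_ne_zero x
    exact ⟨_, ⟨i, rfl⟩, hi⟩
  · rintro _ ⟨i, rfl⟩
    by_cases hi : ∃ x, κ i x ≠ 0
    · obtain ⟨x, hx⟩ := hi
      obtain ⟨U, hU, hxU⟩ := hδα x trivial
      exact ⟨U, hU, fun z hz => hxU (hd i z x (hs i z hz) (hs i x hx))⟩
    · obtain ⟨U, hU, -⟩ := hδα y trivial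
      exact ⟨U, hU, fun z hz => absurd ⟨z, hz⟩ hi⟩

end ThinCovers

/-- For a metrizable compactification pack `(X, X̂, X̃)` with `X`
cylindrical in `X̃`, the conditions (a)–(f) are equivalent. -/
theorem statement1 {T : Type*} [MetricSpace T] [CompactSpace T]
    (X : Set T) (hXcl : IsClosed X) (hXnd : IsNowhereDense X)
    (hcyl : IsCylindrical T X) (n : ℕ) :
    (DimLE ↥X (n : ℤ) ↔ AsdimLE Xᶜ (n + 1)) ∧
    (DimLE ↥X (n : ℤ) ↔ ∀ β : Set (Set T), IsUniformCover Xᶜ β →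
        ∃ α : Set (Set T), IsCanonicalCover X α ∧ Refines β α ∧ MultLE α (n + 2)) ∧
    (DimLE ↥X (n : ℤ) ↔ ∀ β : Set (Set T), IsCanonicalCover X β →
        ∃ α : Set (Set T), IsCanonicalCover X α ∧ Refines β α ∧ MultLE α (n + 2)) ∧
    (DimLE ↥X (n : ℤ) ↔ ∃ α : Set (Set T), IsCanonicalCover X α ∧ MultLE α (n + 2)) ∧
    (DimLE ↥X (n : ℤ) ↔ ∃ α : Set (Set T), (∀ U ∈ α, IsOpen U) ∧
        IsUniformCover Xᶜ α ∧ MultLE α (n + 2)) := by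
  have hca : (∃ α : Set (Set T), (∀ U ∈ α, IsOpen U) ∧ IsUniformCover Xᶜ α ∧ MultLE α (n + 2)) →
      DimLE ↥X (n : ℤ) := by
    rintro ⟨α, hαo, hα, hm⟩
    have : CompactSpace X := isCompact_iff_compactSpace.1 hXcl.isCompact
    exact (IsUniformCover.hasThinCovers hXcl hcyl hαo hα hm).dimLE
  have hac : DimLE ↥X (n : ℤ) → ∀ β : Set (Set T), IsUniformCover Xᶜ β →
      ∃ α : Set (Set T), IsCanonicalCover X α ∧ Refines β α ∧ MultLE α (n + 2) := by
    intro hdim β hβ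
    rcases X.eq_empty_or_nonempty with rfl | hne
    · exact ⟨{univ}, isCanonicalCover_singleton_univ, fun V _ => ⟨univ, rfl, subset_univ V⟩,
        multLE_singleton univ (n + 1)⟩
    · exact exists_isCanonicalCover_of_dimLE hXcl hne hdim hβ
  have hea : (∃ α : Set (Set T), IsCanonicalCover X α ∧ MultLE α (n + 2)) → DimLE ↥X (n : ℤ) :=
    fun ⟨α, hα, hm⟩ => hca ⟨α, fun U hU => (hα.1 U hU).1, hα.isUniformCover hXcl, hm⟩
  obtain ⟨γ, hγ⟩ := exists_isCanonicalCover hXcl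
  have hγu := hγ.isUniformCover hXcl
  refine ⟨⟨fun h β hβ => ?_, fun h => hca ?_⟩, ⟨hac, fun h => hea ?_⟩,
    ⟨fun h β hβ => hac h β (hβ.isUniformCover hXcl), fun h => hea ?_⟩, ⟨fun h => ?_, hea⟩,
    ⟨fun h => ?_, hca⟩⟩
  · obtain ⟨α, hα, hβα, hm⟩ := hac h β hβ
    exact ⟨α, hα.isUniformCover hXcl, hβα, hm⟩
  · obtain ⟨α, hα, hγα, hm⟩ := h γ hγu
    exact hα.exists_isOpen (fun U hU => (hγ.1 U hU).1) hγu.2 hγα hm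
  · obtain ⟨α, hα, -, hm⟩ := h γ hγu
    exact ⟨α, hα, hm⟩
  · obtain ⟨α, hα, -, hm⟩ := h γ hγ
    exact ⟨α, hα, hm⟩
  · obtain ⟨α, hα, -, hm⟩ := hac h γ hγu
    exact ⟨α, hα, hm⟩
  · obtain ⟨α, hα, -, hm⟩ := hac h γ hγu
    exact ⟨α, fun U hU => (hα.1 U hU).1, hα.isUniformCover hXcl, hm⟩
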